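/- Let K be a quadratic field and let c ∈ K. Then: the number of fixed points of f_c in K is at most 2; the number of points of K of exact period 2 under f_c is at most 2; the number of points of K of exact period 3 under f_c is at most 3; and the number of points of K of exact period 4 under f_c is at most 4. Equivalently, the set of K-rational periodic points of f_c contains at most two 1-cycles and at most one cycle of each of the lengths 2, 3 and 4. -/

import Mathlib

/-- The quadratic map `z ↦ z ^ 2 + c`. -/
def fc {K : Type*} [Field K] (c : K) : K → K := fun z => z ^ 2 + c

/-- `α` has exact period `m` under `fc c`. -/
def HasExactPeriod {K : Type*} [Field K] (c : K) (m : ℕ) (α : K) : Prop :=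
  (fc c)^[m] α = α ∧ ∀ j : ℕ, 1 ≤ j → j < m → (fc c)^[j] α ≠ α

/-- `α` has preperiodic type `m_n` under `fc c`: preperiod exactly `n`, eventual period `m`. -/
def HasPreperiodicType {K : Type*} [Field K] (c : K) (m n : ℕ) (α : K) : Prop :=
  HasExactPeriod c m ((fc c)^[n] α) ∧ (fc c)^[n + m - 1] α ≠ (fc c)^[n - 1] α

theorem Int.isCoprime_of_forall_prime {a b : ℤ}
    (h : ∀ p : ℤ, Prime p → p ∣ a → p ∣ b → False) : IsCoprime a b := by
  by_cases h0 : a = 0 ∧ b = 0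
  · exact (h 2 Int.prime_two (by simp [h0.1]) (by simp [h0.2])).elim
  · exact isCoprime_of_prime_dvd h0 fun p hp ha hb => h p hp ha hb

theorem Int.exists_pow_four_of_mul_eq {u v w : ℤ} (h : IsCoprime u v) (hu : 0 ≤ u) (hv : 0 ≤ v)
    (hw : 0 ≤ w) (huv : u * v = w ^ 4) :
    ∃ a b : ℤ, 0 ≤ a ∧ 0 ≤ b ∧ u = a ^ 4 ∧ v = b ^ 4 ∧ a * b = w := by
  have key : ∀ {u v : ℤ}, IsCoprime u v → 0 ≤ u → u * v = w ^ 4 → ∃ a : ℤ, 0 ≤ a ∧ u = a ^ 4 := by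
    intro u v h hu huv
    obtain ⟨d, hd⟩ := exists_associated_pow_of_mul_eq_pow' h huv
    refine ⟨|d|, abs_nonneg d, ?_⟩
    rw [Even.pow_abs (by decide)]
    rcases Int.associated_iff.1 hd with h1 | h1
    · exact h1.symm
    · have : 0 ≤ d ^ 4 := by positivity
      omega
  obtain ⟨a, ha, hua⟩ := key h hu huv
  obtain ⟨b, hb, hvb⟩ := key h.symm hv (by rw [mul_comm]; exact huv)
  refine ⟨a, b, ha, hb, hua, hvb, ?_⟩
  have : (a * b) ^ 4 = w ^ 4 := by rw [mul_pow, ← hua, ← hvb, huv]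
  exact (pow_left_inj₀ (mul_nonneg ha hb) hw (by norm_num)).1 this

theorem Int.sq_emod_eight_of_odd {x : ℤ} (h : x % 2 = 1) : x ^ 2 % 8 = 1 := by
  obtain ⟨k, rfl⟩ : ∃ k, x = 2 * k + 1 := ⟨x / 2, by omega⟩
  have h2 : (k * (k + 1)) % 2 = 0 := by
    rcases Int.emod_two_eq_zero_or_one k with h | h <;> simp [Int.mul_emod, Int.add_emod, h]
  have : (2 * k + 1) ^ 2 = 4 * (k * (k + 1)) + 1 := by ring
  omega

theorem Int.pow_four_emod_sixteen_of_odd {x : ℤ} (h : x % 2 = 1) : x ^ 4 % 16 = 1 := by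
  have h2 := Int.sq_emod_eight_of_odd h
  obtain ⟨k, hk⟩ : ∃ k, x ^ 2 = 8 * k + 1 := ⟨x ^ 2 / 8, by omega⟩
  have : x ^ 4 = 16 * (4 * k ^ 2 + k) + 1 := by
    calc x ^ 4 = (x ^ 2) ^ 2 := by ring
      _ = _ := by rw [hk]; ring
  omega

theorem Int.nonneg_and_nonneg_of_mul_nonneg_of_add_pos {x y : ℤ} (h : 0 ≤ x * y) (hs : 0 < x + y) :
    0 ≤ x ∧ 0 ≤ y := by
  constructor <;> by_contra hc <;> nlinarith

/-- Two coprime nonnegative integers whose product is `p ^ j * a ^ 4`, with `p` prime, are a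
fourth power and `p ^ j` times a fourth power. -/
theorem Int.exists_of_mul_eq_prime_pow_mul_pow_four {p x y a : ℤ} (j : ℕ) (hp : Prime p)
    (hp0 : 0 < p) (h : IsCoprime x y) (ha : 0 ≤ a)
    (hx : 0 ≤ x) (hy : 0 ≤ y) (hxy : x * y = p ^ j * a ^ 4) :
    ∃ α β : ℤ, 0 ≤ α ∧ 0 ≤ β ∧ α * β = a ∧ IsCoprime α β ∧
      ((x = α ^ 4 ∧ y = p ^ j * β ^ 4) ∨ (x = p ^ j * β ^ 4 ∧ y = α ^ 4)) := by
  have key : ∀ {x y : ℤ}, IsCoprime x y → 0 ≤ x → 0 ≤ y → x * y = p ^ j * a ^ 4 → 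
      IsCoprime (p ^ j) y →
      ∃ α β : ℤ, 0 ≤ α ∧ 0 ≤ β ∧ α * β = a ∧ IsCoprime α β ∧ x = p ^ j * β ^ 4 ∧ y = α ^ 4 := by
    intro x y h hx hy hxy h2y
    obtain ⟨x', rfl⟩ : p ^ j ∣ x := h2y.dvd_of_dvd_mul_right ⟨a ^ 4, hxy⟩
    have h2p : 0 < p ^ j := by positivity
    have hcop : IsCoprime x' y := h.of_isCoprime_of_dvd_left (Dvd.intro_left _ rfl)
    obtain ⟨b, c, hb, hc, h1, h3, h4⟩ := Int.exists_pow_four_of_mul_eq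
      hcop (nonneg_of_mul_nonneg_right hx h2p) hy ha
      (mul_left_cancel₀ h2p.ne' (by rw [← hxy]; ring))
    subst h1 h3
    exact ⟨c, b, hc, hb, by rw [mul_comm]; exact h4,
      ((IsCoprime.pow_iff four_pos four_pos).1 hcop).symm, rfl, rfl⟩
  by_cases h2 : p ∣ x
  · obtain ⟨α, β, h1, h3, h4, h5, h6⟩ := key h hx hy hxy (h.of_isCoprime_of_dvd_left h2).pow_left
    exact ⟨α, β, h1, h3, h4, h5, Or.inr h6⟩
  · obtain ⟨α, β, h1, h3, h4, h5, h6, h7⟩ := key h.symm hy hx (by rw [mul_comm]; exact hxy)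
      (((Prime.coprime_iff_not_dvd hp).2 h2).pow_left)
    exact ⟨α, β, h1, h3, h4, h5, Or.inl ⟨h7, h6⟩⟩

theorem Int.dvd_of_sq_dvd_squarefree_mul_pow {p u v d e : ℤ} {j : ℕ} (hd : Squarefree d)
    (hp : Prime p) (hu : p ∣ u) (hv : p ∣ v) (h : u * v = d * e ^ j) : p ∣ e := by
  by_contra hpe
  have h1 : IsCoprime (p * p) (e ^ j) := by
    have := (Prime.coprime_iff_not_dvd hp).2 hpe
    exact (this.mul_left this).pow_right
  exact hp.not_isUnit (hd p (h1.dvd_of_dvd_mul_right (h ▸ mul_dvd_mul hu hv)))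

/-- Factorisation of `c ^ 2 - k ^ 2 = 2 ^ (j + 2) * a ^ 4` for odd `c > 0` prime to `a`. -/
theorem Int.exists_of_sq_sub_sq_eq_two_pow_mul {c k a : ℤ} (j : ℕ) (hc : c % 2 = 1)
    (hc0 : 0 < c) (hca : IsCoprime c a) (ha : 0 ≤ a) (h : c ^ 2 - k ^ 2 = 2 ^ (j + 2) * a ^ 4) :
    ∃ α β : ℤ, 0 ≤ α ∧ 0 ≤ β ∧ α * β = a ∧ IsCoprime α β ∧ c = α ^ 4 + 2 ^ j * β ^ 4 := by
  have hk : k % 2 = 1 := by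
    rcases Int.emod_two_eq_zero_or_one k with hk | hk
    · have h1 : (c ^ 2 - k ^ 2) % 2 = 1 := by simp [Int.sub_emod, pow_two, Int.mul_emod, hc, hk]
      rw [h, pow_add] at h1
      have : (2 : ℤ) ^ j * 2 ^ 2 * a ^ 4 = 2 * (2 * 2 ^ j * a ^ 4) := by ring
      omega
    · exact hk
  obtain ⟨x, hx⟩ : ∃ x, c - k = 2 * x := ⟨(c - k) / 2, by omega⟩
  obtain ⟨y, hy⟩ : ∃ y, c + k = 2 * y := ⟨(c + k) / 2, by omega⟩
  have hxy : x * y = 2 ^ j * a ^ 4 := by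
    have h4 : 4 * (x * y) = 4 * (2 ^ j * a ^ 4) := by
      calc 4 * (x * y) = (2 * x) * (2 * y) := by ring
        _ = 2 ^ (j + 2) * a ^ 4 := by rw [← hx, ← hy, ← h]; ring
        _ = _ := by ring
    linarith
  have hs : x + y = c := by linarith
  have hcop : IsCoprime x y := by
    refine Int.isCoprime_of_forall_prime fun p hp hpx hpy => ?_
    have hpc : p ∣ c := hs ▸ dvd_add hpx hpy
    have : p ∣ 2 ^ j * a ^ 4 := hxy ▸ hpx.mul_right y
    rcases hp.dvd_or_dvd this with h2 | h2
    · have h2 := hp.dvd_of_dvd_pow h2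
      obtain ⟨m, hm⟩ : (2 : ℤ) ∣ c :=
        ((hp.associated_of_dvd Int.prime_two h2).dvd_iff_dvd_left).1 hpc
      omega
    · exact hp.not_isUnit (hca.isUnit_of_dvd' hpc (hp.dvd_of_dvd_pow h2))
  obtain ⟨h1, h2⟩ := Int.nonneg_and_nonneg_of_mul_nonneg_of_add_pos
    (by rw [hxy]; positivity) (hs ▸ hc0)
  obtain ⟨α, β, hα, hβ, h3, h4, h5⟩ := Int.exists_of_mul_eq_prime_pow_mul_pow_four j Int.prime_two
    (by norm_num) hcop ha h1 h2 hxy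
  refine ⟨α, β, hα, hβ, h3, h4, ?_⟩
  rcases h5 with ⟨h5, h6⟩ | ⟨h5, h6⟩ <;> rw [← hs, h5, h6]
  ring

theorem Int.emod_two_eq_one_of_mul {a b : ℤ} (h : (a * b) % 2 = 1) : a % 2 = 1 ∧ b % 2 = 1 := by
  rcases Int.emod_two_eq_zero_or_one a with ha | ha <;>
  rcases Int.emod_two_eq_zero_or_one b with hb | hb <;> simp_all [Int.mul_emod]

theorem Int.squarefree_seven : Squarefree (7 : ℤ) :=
  (Int.prime_iff_natAbs_prime.2 (by norm_num)).squarefree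

set_option maxHeartbeats 1000000 in
/-- The positive integral points on the quartic `M⁴ - 11 M² e² + 32 e⁴ = N²`. -/
theorem Int.quartic_eleven_aux (n : ℕ) : ∀ M e N : ℤ, IsCoprime M e → 0 < e → 0 ≤ N → e < n →
    M ^ 4 - 11 * M ^ 2 * e ^ 2 + 32 * e ^ 4 = N ^ 2 → e = 1 ∧ M ^ 2 = 4 := by
  induction n with
  | zero => intro M e N _ h _ h'; simp at h'; omega
  | succ n ih =>
  intro M e N hMe he hN hen h
  have h7 : Prime (7 : ℤ) := Int.prime_iff_natAbs_prime.2 (by norm_num)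
  have hN0 : N ≠ 0 := by
    rintro rfl
    have : (2 * M ^ 2 - 11 * e ^ 2) ^ 2 + 7 * e ^ 4 = 0 := by linear_combination 4 * h
    have : 0 < e ^ 4 := by positivity
    nlinarith [sq_nonneg (2 * M ^ 2 - 11 * e ^ 2)]
  rcases Int.emod_two_eq_zero_or_one e with he2 | he2
  · -- `e` even
    obtain ⟨f, rfl⟩ : ∃ f, e = 2 * f := ⟨e / 2, by omega⟩
    have hM : M % 2 = 1 := by
      by_contra hM
      have := hMe.isUnit_of_dvd' (x := 2) (by omega) (by omega)
      exact absurd this (by decide)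
    have hM8 := Int.sq_emod_eight_of_odd hM
    have hMf : IsCoprime M f := hMe.of_mul_right_right
    have hM4 : M ^ 4 % 16 = 1 := Int.pow_four_emod_sixteen_of_odd hM
    have hN2 : N % 2 = 1 := by
      rcases Int.emod_two_eq_zero_or_one N with h2 | h2
      · obtain ⟨m, rfl⟩ : ∃ f, N = 2 * f := ⟨N / 2, by omega⟩
        ring_nf at h
        omega
      · exact h2
    obtain ⟨u, hu⟩ : ∃ u, N - (M ^ 2 - 22 * f ^ 2) = 2 * u :=
      ⟨(N - (M ^ 2 - 22 * f ^ 2)) / 2, by omega⟩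
    obtain ⟨v, hv⟩ : ∃ v, N + (M ^ 2 - 22 * f ^ 2) = 2 * v :=
      ⟨(N + (M ^ 2 - 22 * f ^ 2)) / 2, by omega⟩
    have huv : u * v = 7 ^ 1 * f ^ 4 := by
      have : (2 * u) * (2 * v) = 4 * (7 * f ^ 4) := by rw [← hu, ← hv]; linear_combination - h
      linarith
    have hvu : v - u = M ^ 2 - 22 * f ^ 2 := by linarith
    have hcop : IsCoprime u v := by
      refine Int.isCoprime_of_forall_prime fun p hp hpu hpv => ?_
      have hpf := Int.dvd_of_sq_dvd_squarefree_mul_pow Int.squarefree_seven hp hpu hpv (by simpa using huv)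
      have : p ∣ M ^ 2 := by
        have h1 : M ^ 2 = v - u + 22 * f ^ 2 := by linarith
        rw [h1]
        exact dvd_add (dvd_sub hpv hpu) ((hpf.pow two_ne_zero).mul_left _)
      exact hp.not_isUnit (hMf.isUnit_of_dvd' (hp.dvd_of_dvd_pow this) hpf)
    obtain ⟨hu0, hv0⟩ := Int.nonneg_and_nonneg_of_mul_nonneg_of_add_pos (x := u) (y := v)
      (by rw [huv]; positivity) (by omega)
    have hf : 0 < f := by omega
    obtain ⟨b, a, hb, ha, hab, hcop2, ⟨rfl, rfl⟩ | ⟨rfl, rfl⟩⟩ :=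
      Int.exists_of_mul_eq_prime_pow_mul_pow_four 1 h7 (by norm_num) hcop hf.le hu0 hv0 huv
    · -- `u = b⁴`, `v = 7 a⁴`
      exfalso
      have h1 : 7 * a ^ 4 + 22 * a ^ 2 * b ^ 2 - b ^ 4 = 8 * (M ^ 2 / 8) + 1 := by
        rw [← hab] at hvu
        have : M ^ 2 = 8 * (M ^ 2 / 8) + 1 := by omega
        rw [← this]; linear_combination hvu
      have h2 := congrArg (Int.cast : ℤ → ZMod 8) h1
      push_cast at h2
      rw [show (8 : ZMod 8) = 0 from rfl, zero_mul] at h2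
      revert h2
      generalize (a : ZMod 8) = a', (b : ZMod 8) = b'
      revert a' b'
      decide
    · subst hab
      have hC : (b ^ 2 + 11 * a ^ 2) ^ 2 - M ^ 2 = 2 ^ (5 + 2) * a ^ 4 := by linear_combination hvu
      have hC2 : (b ^ 2 + 11 * a ^ 2) % 2 = 1 := by
        rcases Int.emod_two_eq_zero_or_one (b ^ 2 + 11 * a ^ 2) with h2 | h2
        · obtain ⟨m, hm⟩ : ∃ m, b ^ 2 + 11 * a ^ 2 = 2 * m := ⟨(b ^ 2 + 11 * a ^ 2) / 2, by omega⟩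
          rw [hm] at hC
          ring_nf at hC
          omega
        · exact h2
      have ha0 : 0 < a := pos_of_mul_pos_right hf hb
      have hb0 : 0 < b := pos_of_mul_pos_left hf ha
      have hca : IsCoprime (b ^ 2 + 11 * a ^ 2) a := by
        have := (hcop2.pow_left (m := 2)).add_mul_right_left (11 * a)
        rwa [show b ^ 2 + 11 * a * a = b ^ 2 + 11 * a ^ 2 by ring] at this
      obtain ⟨α, β, hα, hβ, hαβ, hcop3, h3⟩ := Int.exists_of_sq_sub_sq_eq_two_pow_mul 5 hC2
        (by positivity) hca ha hC
      subst hαβ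
      have hβ0 : 0 < β := pos_of_mul_pos_right ha0 hα
      have hα0 : 0 < α := pos_of_mul_pos_left ha0 hβ
      have hlt : β < n := by
        have : 1 ≤ b * α := mul_pos hb0 hα0
        push_cast at hen
        nlinarith
      obtain ⟨-, h4⟩ := ih α β b hcop3 hβ0 hb hlt (by linear_combination -h3)
      rw [h3, show α ^ 4 = (α ^ 2) ^ 2 by ring, h4] at hC2
      omega
  · -- `e` odd
    have he8 := Int.sq_emod_eight_of_odd he2
    have he4 := Int.pow_four_emod_sixteen_of_odd he2
    have hM : M % 2 = 0 := by
      by_contra hM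
      have h1 := Int.sq_emod_eight_of_odd (x := M * e) (by
        have : M % 2 = 1 := by omega
        simp [Int.mul_emod, this, he2])
      have h3 := Int.pow_four_emod_sixteen_of_odd (x := M) (by omega)
      rw [mul_pow] at h1
      rw [show 11 * M ^ 2 * e ^ 2 = 11 * (M ^ 2 * e ^ 2) by ring] at h
      rcases Int.emod_two_eq_zero_or_one N with h2 | h2
      · obtain ⟨m, rfl⟩ : ∃ f, N = 2 * f := ⟨N / 2, by omega⟩
        ring_nf at h
        omega
      · have := Int.sq_emod_eight_of_odd h2
        omega
    obtain ⟨k, rfl⟩ : ∃ k, M = 2 * k := ⟨M / 2, by omega⟩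
    have hN2 : N % 2 = 0 := by
      by_contra h2
      have := Int.sq_emod_eight_of_odd (x := N) (by omega)
      ring_nf at h
      omega
    obtain ⟨N, rfl⟩ : ∃ k, N = 2 * k := ⟨N / 2, by omega⟩
    have huv : (4 * N - 8 * k ^ 2 + 11 * e ^ 2) * (4 * N + 8 * k ^ 2 - 11 * e ^ 2) = 7 ^ 1 * e ^ 4 := by
      linear_combination -4 * h
    have hke : IsCoprime k e := hMe.of_mul_left_right
    have hcop : IsCoprime (4 * N - 8 * k ^ 2 + 11 * e ^ 2) (4 * N + 8 * k ^ 2 - 11 * e ^ 2) := by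
      refine Int.isCoprime_of_forall_prime fun p hp hpu hpv => ?_
      have hpf := Int.dvd_of_sq_dvd_squarefree_mul_pow Int.squarefree_seven hp hpu hpv (by simpa using huv)
      have : p ∣ 2 ^ 4 * k ^ 2 := by
        have h1 : 2 ^ 4 * k ^ 2 = (4 * N + 8 * k ^ 2 - 11 * e ^ 2) - (4 * N - 8 * k ^ 2 + 11 * e ^ 2)
          + 22 * e ^ 2 := by ring
        rw [h1]
        exact dvd_add (dvd_sub hpv hpu) ((hpf.pow two_ne_zero).mul_left _)
      rcases hp.dvd_or_dvd this with h2 | h2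
      · obtain ⟨m, hm⟩ : (2 : ℤ) ∣ e :=
          ((hp.associated_of_dvd Int.prime_two (hp.dvd_of_dvd_pow h2)).dvd_iff_dvd_left).1 hpf
        omega
      · exact hp.not_isUnit (hke.isUnit_of_dvd' (hp.dvd_of_dvd_pow h2) hpf)
    obtain ⟨hu0, hv0⟩ := Int.nonneg_and_nonneg_of_mul_nonneg_of_add_pos 
      (by rw [huv]; positivity) (by omega)
    obtain ⟨b, a, hb, ha, hab, hcop2, ⟨hu, hv⟩ | ⟨hu, hv⟩⟩ :=
      Int.exists_of_mul_eq_prime_pow_mul_pow_four 1 h7 (by norm_num) hcop he.le hu0 hv0 huv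
    · exfalso
      subst hab
      obtain ⟨hb2, ha2⟩ := Int.emod_two_eq_one_of_mul he2
      have h1 := Int.pow_four_emod_sixteen_of_odd hb2
      have h2 := Int.pow_four_emod_sixteen_of_odd ha2
      omega
    · subst hab
      obtain ⟨hb2, ha2⟩ := Int.emod_two_eq_one_of_mul he2
      have hb8 := Int.sq_emod_eight_of_odd hb2
      have ha8 := Int.sq_emod_eight_of_odd ha2
      have ha0 : 0 < a := pos_of_mul_pos_right he hb
      have hb0 : 0 < b := pos_of_mul_pos_left he ha
      obtain ⟨C, hC⟩ : ∃ C, b ^ 2 + 11 * a ^ 2 = 4 * C := ⟨(b ^ 2 + 11 * a ^ 2) / 4, by omega⟩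
      have hC2 : C % 2 = 1 := by
        obtain ⟨x, hx⟩ : ∃ x, a ^ 2 = 8 * x + 1 := ⟨a ^ 2 / 8, by omega⟩
        obtain ⟨y, hy⟩ : ∃ x, b ^ 2 = 8 * x + 1 := ⟨b ^ 2 / 8, by omega⟩
        omega
      have hk : b ^ 4 + 22 * a ^ 2 * b ^ 2 - 7 * a ^ 4 = 16 * k ^ 2 := by
        linear_combination hu - hv
      have hC' : C ^ 2 - k ^ 2 = 2 ^ (1 + 2) * a ^ 4 := by
        have : 16 * (C ^ 2 - k ^ 2) = 16 * (8 * a ^ 4) := by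
          linear_combination hk - (b ^ 2 + 11 * a ^ 2 + 4 * C) * hC
        norm_num at this ⊢
        exact this
      have hca : IsCoprime C a := by
        have h1 := (hcop2.pow_left (m := 2)).add_mul_right_left (11 * a)
        rw [show b ^ 2 + 11 * a * a = 4 * C by rw [← hC]; ring] at h1
        exact h1.of_mul_left_right
      obtain ⟨α, β, hα, hβ, hαβ, hcop3, h3⟩ := Int.exists_of_sq_sub_sq_eq_two_pow_mul 1 hC2
        (by nlinarith) hca ha hC'
      subst hαβ
      have hβ0 : 0 < β := pos_of_mul_pos_right ha0 hα
      have hα0 : 0 < α := pos_of_mul_pos_left ha0 hβ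
      have hb' : b ^ 2 = 4 * α ^ 4 - 11 * α ^ 2 * β ^ 2 + 8 * β ^ 4 := by
        linear_combination hC + 4 * h3
      have hβ2 := (Int.emod_two_eq_one_of_mul ha2).2
      have hone : β = 1 ∧ α = 1 := by
        have h1 : 1 ≤ b * α := mul_pos hb0 hα0
        rcases eq_or_lt_of_le h1 with h1 | h1
        · have hb1 : b = 1 := Int.eq_one_of_mul_eq_one_right hb h1.symm
          have hα1 : α = 1 := Int.eq_one_of_mul_eq_one_left hα h1.symm
          subst hb1 hα1
          have : (8 * β ^ 2 - 3) * ((β - 1) * (β + 1)) = 0 := by linear_combination -hb'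
          rcases mul_eq_zero.1 this with h | h
          · omega
          · rcases mul_eq_zero.1 h with h | h <;> constructor <;> omega
        · have hlt : β < n := by
            push_cast at hen
            nlinarith
          have hcop4 : IsCoprime (2 * α) β := by
            refine IsCoprime.mul_left ?_ hcop3
            exact ⟨-(β / 2), 1, by omega⟩
          obtain ⟨h5, h4⟩ := ih (2 * α) β (2 * b) hcop4 hβ0 (by positivity) hlt
            (by linear_combination -4 * hb')
          exact ⟨h5, (pow_eq_one_iff_of_nonneg hα two_ne_zero).1 (by linarith)⟩
      obtain ⟨rfl, rfl⟩ := hone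
      have hb1 : b = 1 := (pow_eq_one_iff_of_nonneg hb two_ne_zero).1 (by linarith)
      subst hb1
      constructor
      · norm_num
      · norm_num at hk
        linarith

/-- The integral points on the quartic `M⁴ - 11 M² e² + 32 e⁴ = N²`. -/
theorem Int.quartic_eleven {M e N : ℤ} (h : IsCoprime M e) (he : e ≠ 0)
    (h1 : M ^ 4 - 11 * M ^ 2 * e ^ 2 + 32 * e ^ 4 = N ^ 2) : e ^ 2 = 1 ∧ M ^ 2 = 4 := by
  obtain ⟨h2, h3⟩ := Int.quartic_eleven_aux (|e| + 1).toNat M |e| |N| ((IsCoprime.abs_right_iff _ _).2 h)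
    (abs_pos.2 he) (abs_nonneg N) (by simp) (by simpa [Even.pow_abs (by decide : Even 4)] using h1)
  exact ⟨by rw [← sq_abs, h2, one_pow], h3⟩

theorem Int.prime_seven : Prime (7 : ℤ) := Int.prime_iff_natAbs_prime.2 (by norm_num)

/-- Splitting `u v = 7³ f⁴` when `v - u = m² + 26 f²`. -/
theorem Int.exists_of_mul_eq_seven_pow_three_mul {u v m f : ℤ} (hmf : IsCoprime m f) (hf : 0 < f)
    (hu : 0 ≤ u) (hv : 0 ≤ v) (huv : u * v = 7 ^ 3 * f ^ 4) (h : v - u = m ^ 2 + 26 * f ^ 2)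
    (hpar : (m % 4 = 0 ∧ f % 2 = 1) ∨ m % 2 = 1) :
    ∃ a b : ℤ, 0 ≤ a ∧ 0 ≤ b ∧ a * b = f ∧ IsCoprime a b ∧ IsCoprime 7 b ∧
      (m ^ 2 = b ^ 4 - 26 * a ^ 2 * b ^ 2 - 343 * a ^ 4 ∨
        m ^ 2 = 49 * a ^ 4 - 26 * a ^ 2 * b ^ 2 - 7 * b ^ 4) := by
  have hm : ∀ p : ℤ, Prime p → p ∣ u → p ∣ v → ¬ p ∣ f := by
    intro p hp hpu hpv hpf
    have : p ∣ m ^ 2 := by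
      rw [show m ^ 2 = v - u - 26 * f ^ 2 by linarith]
      exact dvd_sub (dvd_sub hpv hpu) ((hpf.pow two_ne_zero).mul_left _)
    exact hp.not_isUnit (hmf.isUnit_of_dvd' (hp.dvd_of_dvd_pow this) hpf)
  -- `7 * x⁴ - 2 x² y² - y⁴` type expressions are excluded by congruences
  have hbad : ∀ x y r s : ℤ, r % 16 = 7 → s % 16 = 1 → (f % 2 = 1 → (x * y) % 2 = 1) →
      m ^ 2 ≠ r * x ^ 4 - 26 * x ^ 2 * y ^ 2 - s * y ^ 4 := by
    intro x y r s hr hs hxy heq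
    obtain ⟨r, rfl⟩ : ∃ t, r = 16 * t + 7 := ⟨r / 16, by omega⟩
    obtain ⟨s, rfl⟩ : ∃ t, s = 16 * t + 1 := ⟨s / 16, by omega⟩
    rcases hpar with ⟨hm, hf⟩ | hm
    · obtain ⟨h1, h2⟩ := Int.emod_two_eq_one_of_mul (hxy hf)
      have h3 := Int.pow_four_emod_sixteen_of_odd h1
      have h4 := Int.pow_four_emod_sixteen_of_odd h2
      have h5 := Int.sq_emod_eight_of_odd (hxy hf)
      obtain ⟨k, rfl⟩ : ∃ k, m = 4 * k := ⟨m / 4, by omega⟩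
      rw [mul_pow] at h5
      ring_nf at heq h5
      omega
    · have h1 := Int.sq_emod_eight_of_odd hm
      have h2 : 7 * x ^ 4 - 26 * x ^ 2 * y ^ 2 - y ^ 4 =
          8 * (m ^ 2 / 8 - 2 * r * x ^ 4 + 2 * s * y ^ 4) + 1 := by
        have : m ^ 2 = 8 * (m ^ 2 / 8) + 1 := by omega
        linear_combination this - heq
      have h2 := congrArg (Int.cast : ℤ → ZMod 8) h2
      push_cast at h2
      rw [show (8 : ZMod 8) = 0 from rfl, zero_mul] at h2
      revert h2
      generalize (x : ZMod 8) = a', (y : ZMod 8) = b'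
      revert a' b'
      decide
  by_cases h7 : (7 : ℤ) ∣ u ∧ (7 : ℤ) ∣ v
  · have h7f := hm 7 Int.prime_seven h7.1 h7.2
    obtain ⟨⟨u, rfl⟩, ⟨v, rfl⟩⟩ := h7
    have huv1 : u * v = 7 ^ 1 * f ^ 4 := by linarith
    have hcop : IsCoprime u v := Int.isCoprime_of_forall_prime fun p hp hpu hpv =>
      hm p hp (hpu.mul_left _) (hpv.mul_left _)
        (Int.dvd_of_sq_dvd_squarefree_mul_pow Int.squarefree_seven hp hpu hpv (by simpa using huv1))
    obtain ⟨b, a, hb, ha, hab, hcop2, ⟨rfl, rfl⟩ | ⟨rfl, rfl⟩⟩ :=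
      Int.exists_of_mul_eq_prime_pow_mul_pow_four 1 Int.prime_seven (by norm_num) hcop hf.le
        (by linarith) (by linarith) huv1
    · refine ⟨a, b, ha, hb, by rw [← hab, mul_comm], hcop2.symm, ?_, Or.inr ?_⟩
      · exact (Prime.coprime_iff_not_dvd Int.prime_seven).2 fun h => h7f (hab ▸ h.mul_right a)
      · rw [← hab] at h; linear_combination -h
    · exfalso
      refine hbad b a 7 49 (by norm_num) (by norm_num) (by rw [hab]; exact id) ?_
      rw [← hab] at h; linear_combination -h
  · have hcop : IsCoprime u v := by
      refine Int.isCoprime_of_forall_prime fun p hp hpu hpv => ?_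
      have hpf := hm p hp hpu hpv
      have h1 : p ∣ 7 ^ 3 * f ^ 4 := huv ▸ hpu.mul_right v
      have h2 := hp.dvd_of_dvd_pow
        ((hp.dvd_or_dvd h1).resolve_right fun h => hpf (hp.dvd_of_dvd_pow h))
      have h3 := (hp.associated_of_dvd Int.prime_seven h2).dvd_iff_dvd_left (c := u)
      have h4 := (hp.associated_of_dvd Int.prime_seven h2).dvd_iff_dvd_left (c := v)
      exact h7 ⟨h3.1 hpu, h4.1 hpv⟩
    obtain ⟨b, a, hb, ha, hab, hcop2, ⟨rfl, rfl⟩ | ⟨rfl, rfl⟩⟩ :=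
      Int.exists_of_mul_eq_prime_pow_mul_pow_four 3 Int.prime_seven (by norm_num) hcop hf.le
        hu hv huv
    · exfalso
      refine hbad a b 343 1 (by norm_num) (by norm_num) (by rw [mul_comm, hab]; exact id) ?_
      rw [← hab] at h; linear_combination -h
    · refine ⟨a, b, ha, hb, by rw [← hab, mul_comm], hcop2.symm, ?_, Or.inl ?_⟩
      · exact (IsCoprime.pow_iff three_pos four_pos).1 hcop.of_mul_left_left
      · rw [← hab] at h; linear_combination -h

theorem Int.exists_of_sq_sub_thirteen_odd {g h m : ℤ} (hgh : IsCoprime g h) (hh : 0 < h)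
    (hm : m % 2 = 1) (heq : (g ^ 2 - 13 * h ^ 2) ^ 2 - 512 * h ^ 4 = m ^ 2) :
    ∃ α β : ℤ, 0 < α ∧ 0 < β ∧ α * β = h ∧ IsCoprime α β ∧ α % 2 = 1 ∧
      g ^ 2 = α ^ 4 + 13 * α ^ 2 * β ^ 2 + 128 * β ^ 4 := by
  have hca : IsCoprime (g ^ 2 - 13 * h ^ 2) h := by
    have := (hgh.pow_left (m := 2)).add_mul_right_left (-13 * h)
    rwa [show g ^ 2 + -13 * h * h = g ^ 2 - 13 * h ^ 2 by ring] at this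
  generalize hC : g ^ 2 - 13 * h ^ 2 = C at *
  have hC2 : C % 2 = 1 := by
    have := Int.sq_emod_eight_of_odd hm
    rcases Int.emod_two_eq_zero_or_one C with h2 | h2
    · obtain ⟨c, rfl⟩ : ∃ c, C = 2 * c := ⟨C / 2, by omega⟩
      ring_nf at heq
      omega
    · exact h2
  have hpos : ∀ α β : ℤ, 0 ≤ α → 0 ≤ β → α * β = h → 0 < α ∧ 0 < β := fun α β hα hβ e => by
    subst e; exact ⟨pos_of_mul_pos_left hh hβ, pos_of_mul_pos_right hh hα⟩
  have hC0 : C ≠ 0 := by rintro rfl; omega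
  rcases lt_or_gt_of_ne hC0 with hneg | hpos'
  · exfalso
    obtain ⟨α, β, hα, hβ, hαβ, hcop3, h3⟩ := Int.exists_of_sq_sub_sq_eq_two_pow_mul (c := -C) (k := m) 7
      (by omega) (by omega) hca.neg_left hh.le (by linear_combination heq)
    obtain ⟨h1, h2⟩ := hpos α β hα hβ hαβ
    subst hαβ
    have : (2 * α ^ 2 - 13 * β ^ 2) ^ 2 + 343 * β ^ 4 + 4 * g ^ 2 = 0 := by
      linear_combination 4 * hC - 4 * h3
    have : 0 < β ^ 4 := by positivity
    nlinarith [sq_nonneg (2 * α ^ 2 - 13 * β ^ 2)]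
  · obtain ⟨α, β, hα, hβ, hαβ, hcop3, h3⟩ := Int.exists_of_sq_sub_sq_eq_two_pow_mul (c := C) (k := m) 7
      hC2 hpos' hca hh.le (by linear_combination heq)
    obtain ⟨h1, h2⟩ := hpos α β hα hβ hαβ
    refine ⟨α, β, h1, h2, hαβ, hcop3, ?_, ?_⟩
    · by_contra h4
      obtain ⟨x, rfl⟩ : ∃ c, α = 2 * c := ⟨α / 2, by omega⟩
      ring_nf at h3
      omega
    · subst hαβ
      linear_combination hC + h3

theorem Int.exists_of_sq_sub_thirteen_even {g h k : ℤ} (hgh : IsCoprime g h) (hh : 0 < h)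
    (hg2 : g % 2 = 1) (hh2 : h % 2 = 1)
    (heq : (g ^ 2 - 13 * h ^ 2) ^ 2 - 512 * h ^ 4 = (4 * k) ^ 2) :
    ∃ α β : ℤ, 0 < α ∧ 0 < β ∧ α * β = h ∧ IsCoprime α β ∧
      g ^ 2 = 4 * α ^ 4 + 13 * α ^ 2 * β ^ 2 + 32 * β ^ 4 := by
  have hca : IsCoprime (g ^ 2 - 13 * h ^ 2) h := by
    have := (hgh.pow_left (m := 2)).add_mul_right_left (-13 * h)
    rwa [show g ^ 2 + -13 * h * h = g ^ 2 - 13 * h ^ 2 by ring] at this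
  have hg8 := Int.sq_emod_eight_of_odd hg2
  have hh8 := Int.sq_emod_eight_of_odd hh2
  obtain ⟨C, hC⟩ : ∃ C, g ^ 2 - 13 * h ^ 2 = 4 * C := ⟨(g ^ 2 - 13 * h ^ 2) / 4, by omega⟩
  have hC2 : C % 2 = 1 := by
    obtain ⟨x, hx⟩ : ∃ x, g ^ 2 = 8 * x + 1 := ⟨g ^ 2 / 8, by omega⟩
    obtain ⟨y, hy⟩ : ∃ x, h ^ 2 = 8 * x + 1 := ⟨h ^ 2 / 8, by omega⟩
    omega
  rw [hC] at hca heq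
  have hca := hca.of_mul_left_right
  have heq : C ^ 2 - k ^ 2 = 2 ^ (3 + 2) * h ^ 4 := by
    norm_num
    linarith
  have hpos : ∀ α β : ℤ, 0 ≤ α → 0 ≤ β → α * β = h → 0 < α ∧ 0 < β := fun α β hα hβ e => by
    subst e; exact ⟨pos_of_mul_pos_left hh hβ, pos_of_mul_pos_right hh hα⟩
  have hC0 : C ≠ 0 := by rintro rfl; omega
  rcases lt_or_gt_of_ne hC0 with hneg | hpos'
  · exfalso
    obtain ⟨α, β, hα, hβ, hαβ, hcop3, h3⟩ := Int.exists_of_sq_sub_sq_eq_two_pow_mul (c := -C) (k := k) 3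
      (by omega) (by omega) hca.neg_left hh.le (by linear_combination heq)
    obtain ⟨h1, h2⟩ := hpos α β hα hβ hαβ
    subst hαβ
    have : (8 * α ^ 2 - 13 * β ^ 2) ^ 2 + 343 * β ^ 4 + 16 * g ^ 2 = 0 := by
      linear_combination 16 * hC - 64 * h3
    have : 0 < β ^ 4 := by positivity
    nlinarith [sq_nonneg (8 * α ^ 2 - 13 * β ^ 2)]
  · obtain ⟨α, β, hα, hβ, hαβ, hcop3, h3⟩ := Int.exists_of_sq_sub_sq_eq_two_pow_mul (c := C) 3
      hC2 hpos' hca hh.le heq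
    obtain ⟨h1, h2⟩ := hpos α β hα hβ hαβ
    refine ⟨α, β, h1, h2, hαβ, hcop3, ?_⟩
    subst hαβ
    linear_combination hC + 4 * h3

set_option maxHeartbeats 1000000 in
/-- The positive integral points on the quartic `M⁴ + 13 M² e² + 128 e⁴ = N²`. -/
theorem Int.quartic_thirteen_aux (n : ℕ) : ∀ M e N : ℤ, IsCoprime M e → 0 < e → 0 ≤ N → e < n →
    M ^ 4 + 13 * M ^ 2 * e ^ 2 + 128 * e ^ 4 = N ^ 2 → e = 1 ∧ M ^ 2 = 4 := by
  induction n with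
  | zero => intro M e N _ h _ h'; simp at h'; omega
  | succ n ih =>
  intro M e N hMe he hN hen h
  rcases Int.emod_two_eq_zero_or_one e with he2 | he2
  · exfalso
    obtain ⟨f, rfl⟩ : ∃ f, e = 2 * f := ⟨e / 2, by omega⟩
    have hf : 0 < f := by omega
    have hM : M % 2 = 1 := by
      by_contra hM
      have := hMe.isUnit_of_dvd' (x := 2) (by omega) (by omega)
      exact absurd this (by decide)
    have hM8 := Int.sq_emod_eight_of_odd hM
    have hM4 := Int.pow_four_emod_sixteen_of_odd hM
    have hMf : IsCoprime M f := hMe.of_mul_right_right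
    have hN2 : N % 2 = 1 := by
      rcases Int.emod_two_eq_zero_or_one N with h2 | h2
      · obtain ⟨m, rfl⟩ : ∃ f, N = 2 * f := ⟨N / 2, by omega⟩
        ring_nf at h
        omega
      · exact h2
    obtain ⟨u, hu⟩ : ∃ u, N - (M ^ 2 + 26 * f ^ 2) = 2 * u :=
      ⟨(N - (M ^ 2 + 26 * f ^ 2)) / 2, by omega⟩
    obtain ⟨v, hv⟩ : ∃ v, N + (M ^ 2 + 26 * f ^ 2) = 2 * v :=
      ⟨(N + (M ^ 2 + 26 * f ^ 2)) / 2, by omega⟩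
    have huv : u * v = 7 ^ 3 * f ^ 4 := by
      have : (2 * u) * (2 * v) = 4 * (7 ^ 3 * f ^ 4) := by rw [← hu, ← hv]; linear_combination - h
      linarith
    obtain ⟨hu0, hv0⟩ := Int.nonneg_and_nonneg_of_mul_nonneg_of_add_pos (x := u) (y := v)
      (by rw [huv]; positivity) (by omega)
    obtain ⟨a, b, ha, hb, hab, hcop, h7b, hcase⟩ := Int.exists_of_mul_eq_seven_pow_three_mul
      hMf hf hu0 hv0 huv (by linarith) (Or.inr hM)
    subst hab
    have ha0 : 0 < a := pos_of_mul_pos_left hf hb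
    have hb0 : 0 < b := pos_of_mul_pos_right hf ha
    have key : ∀ g h w m : ℤ, IsCoprime g h → 0 < h → 0 < w → w * h = a * b → m % 2 = 1 →
        (g ^ 2 - 13 * h ^ 2) ^ 2 - 512 * h ^ 4 = m ^ 2 → False := by
      intro g h w m hgh hh hw hwh hm heq
      obtain ⟨α, β, hα, hβ, rfl, hcop, hα2, h3⟩ :=
        Int.exists_of_sq_sub_thirteen_odd hgh hh hm heq
      have hlt : β < n := by
        have : 1 ≤ w * α := mul_pos hw hα
        push_cast at hen
        nlinarith
      obtain ⟨-, h4⟩ := ih α β |g| hcop hβ (abs_nonneg g) hlt (by rw [sq_abs, h3])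
      have := Int.sq_emod_eight_of_odd hα2
      omega
    rcases hcase with h1 | h1
    · exact key b a b M hcop.symm ha0 hb0 (mul_comm _ _) hM (by rw [h1]; ring)
    · exact key (7 * a) b a (7 * M) (h7b.mul_left hcop) hb0 ha0 rfl (by omega)
        (by linear_combination -49 * h1)
  · have he8 := Int.sq_emod_eight_of_odd he2
    have he4 := Int.pow_four_emod_sixteen_of_odd he2
    have hM : M % 2 = 0 := by
      by_contra hM
      have h1 := Int.sq_emod_eight_of_odd (x := M * e) (by
        have : M % 2 = 1 := by omega
        simp [Int.mul_emod, this, he2])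
      have h3 := Int.pow_four_emod_sixteen_of_odd (x := M) (by omega)
      rw [mul_pow] at h1
      rw [show 13 * M ^ 2 * e ^ 2 = 13 * (M ^ 2 * e ^ 2) by ring] at h
      rcases Int.emod_two_eq_zero_or_one N with h2 | h2
      · obtain ⟨m, rfl⟩ : ∃ f, N = 2 * f := ⟨N / 2, by omega⟩
        ring_nf at h
        omega
      · have := Int.sq_emod_eight_of_odd h2
        omega
    obtain ⟨k, rfl⟩ : ∃ k, M = 2 * k := ⟨M / 2, by omega⟩
    have hN2 : N % 2 = 0 := by
      by_contra h2
      have := Int.sq_emod_eight_of_odd (x := N) (by omega)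
      ring_nf at h
      omega
    obtain ⟨N, rfl⟩ : ∃ k, N = 2 * k := ⟨N / 2, by omega⟩
    have huv : (4 * N - 8 * k ^ 2 - 13 * e ^ 2) * (4 * N + 8 * k ^ 2 + 13 * e ^ 2) =
        7 ^ 3 * e ^ 4 := by
      linear_combination -4 * h
    have hN0 : 0 < N := by
      rcases eq_or_ne N 0 with rfl | hN0
      · have : 0 < e ^ 4 := by positivity
        nlinarith [sq_nonneg (k ^ 2), sq_nonneg (k * e)]
      · omega
    have hke : IsCoprime k e := hMe.of_mul_left_right
    have h4e : IsCoprime (4 * k) e := by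
      rw [show 4 * k = 2 * (2 * k) by ring]
      exact hMe.of_mul_left_left.mul_left hMe
    obtain ⟨hu0, hv0⟩ := Int.nonneg_and_nonneg_of_mul_nonneg_of_add_pos
      (by rw [huv]; positivity) (by omega)
    obtain ⟨a, b, ha, hb, hab, hcop, h7b, hcase⟩ := Int.exists_of_mul_eq_seven_pow_three_mul
      (m := 4 * k) h4e he hu0 hv0 huv (by ring) (Or.inl ⟨by omega, he2⟩)
    subst hab
    have ha0 : 0 < a := pos_of_mul_pos_left he hb
    have hb0 : 0 < b := pos_of_mul_pos_right he ha
    obtain ⟨ha2, hb2⟩ := Int.emod_two_eq_one_of_mul he2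
    have key : ∀ g h w m : ℤ, IsCoprime g h → g % 2 = 1 → h % 2 = 1 → 0 < h → 0 < w →
        w * h = a * b → (w = 1 → g ^ 2 ≤ 49) →
        (g ^ 2 - 13 * h ^ 2) ^ 2 - 512 * h ^ 4 = (4 * m) ^ 2 → h = 1 ∧ g ^ 2 = 49 := by
      intro g h w m hgh hg2 hh2 hh hw hwh hwg heq
      obtain ⟨α, β, hα, hβ, rfl, hcop, h3⟩ :=
        Int.exists_of_sq_sub_thirteen_even hgh hh hg2 hh2 heq
      have hone : β = 1 ∧ α = 1 := by
        have h1 : 1 ≤ w * α := mul_pos hw hα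
        rcases eq_or_lt_of_le h1 with h1 | h1
        · have hw1 : w = 1 := Int.eq_one_of_mul_eq_one_right hw.le h1.symm
          have hα1 : α = 1 := Int.eq_one_of_mul_eq_one_left hα.le h1.symm
          have := hwg hw1
          subst hα1
          refine ⟨?_, rfl⟩
          by_contra hβ1
          have : 2 ≤ β := by omega
          nlinarith [pow_le_pow_left₀ (by norm_num) this 4]
        · have hlt : β < n := by
            push_cast at hen
            nlinarith
          have hcop4 : IsCoprime (2 * α) β := by
            refine IsCoprime.mul_left ?_ hcop
            have := (Int.emod_two_eq_one_of_mul hh2).2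
            exact ⟨-(β / 2), 1, by omega⟩
          obtain ⟨h5, h4⟩ := ih (2 * α) β |2 * g| hcop4 hβ (abs_nonneg _) hlt
            (by rw [sq_abs]; linear_combination -4 * h3)
          exact ⟨h5, (pow_eq_one_iff_of_nonneg hα.le two_ne_zero).1 (by linarith)⟩
      obtain ⟨rfl, rfl⟩ := hone
      exact ⟨by norm_num, by rw [h3]; norm_num⟩
    rcases hcase with h1 | h1
    · exfalso
      obtain ⟨-, h2⟩ := key b a b k hcop.symm hb2 ha2 ha0 hb0 (mul_comm _ _)
        (by rintro rfl; norm_num) (by linear_combination -h1)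
      have h7 : (7 : ℤ) ∣ b := Int.prime_seven.dvd_of_dvd_pow (n := 2) ⟨7, by rw [h2]; norm_num⟩
      exact Int.prime_seven.not_isUnit (h7b.isUnit_of_dvd' dvd_rfl h7)
    · obtain ⟨rfl, h2⟩ := key (7 * a) b a (7 * k) (h7b.mul_left hcop) (by omega) hb2 hb0 ha0 rfl
        (by rintro rfl; norm_num) (by linear_combination -49 * h1)
      have ha1 : a = 1 := (pow_eq_one_iff_of_nonneg ha two_ne_zero).1 (by linarith)
      subst ha1
      refine ⟨by norm_num, ?_⟩
      norm_num at h1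
      linarith

/-- The integral points on the quartic `M⁴ + 13 M² e² + 128 e⁴ = N²`. -/
theorem Int.quartic_thirteen {M e N : ℤ} (h : IsCoprime M e) (he : e ≠ 0)
    (h1 : M ^ 4 + 13 * M ^ 2 * e ^ 2 + 128 * e ^ 4 = N ^ 2) : e ^ 2 = 1 ∧ M ^ 2 = 4 := by
  obtain ⟨h2, h3⟩ := Int.quartic_thirteen_aux (|e| + 1).toNat M |e| |N|
    ((IsCoprime.abs_right_iff _ _).2 h)
    (abs_pos.2 he) (abs_nonneg N) (by simp)
    (by simpa [Even.pow_abs (by decide : Even 4)] using h1)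
  exact ⟨by rw [← sq_abs, h2, one_pow], h3⟩

theorem Int.exists_sq_of_mul_eq_sq {u v w : ℤ} (h : IsCoprime u v) (hu : 0 < u) (hv : 0 < v)
    (huv : u * v = w ^ 2) :
    ∃ a b : ℤ, 0 < a ∧ 0 < b ∧ u = a ^ 2 ∧ v = b ^ 2 ∧ a * b = |w| := by
  have key : ∀ {u v : ℤ}, IsCoprime u v → 0 < u → u * v = w ^ 2 → ∃ a : ℤ, 0 < a ∧ u = a ^ 2 := by
    intro u v h hu huv
    obtain ⟨d, hd⟩ := exists_associated_pow_of_mul_eq_pow' h huv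
    have hd' : d ^ 2 = u := by
      rcases Int.associated_iff.1 hd with h1 | h1
      · exact h1
      · nlinarith [sq_nonneg d]
    refine ⟨|d|, abs_pos.2 (by rintro rfl; omega), by rw [sq_abs, hd']⟩
  obtain ⟨a, ha, hua⟩ := key h hu huv
  obtain ⟨b, hb, hvb⟩ := key h.symm hv (by rw [mul_comm]; exact huv)
  refine ⟨a, b, ha, hb, hua, hvb, ?_⟩
  have : (a * b) ^ 2 = |w| ^ 2 := by rw [mul_pow, ← hua, ← hvb, huv, sq_abs]
  exact (pow_left_inj₀ (mul_pos ha hb).le (abs_nonneg w) two_ne_zero).1 this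

theorem Int.squarefree_five : Squarefree (5 : ℤ) :=
  (Int.prime_iff_natAbs_prime.2 (by norm_num)).squarefree

/-- If `z ^ 2 = x ^ 2 + y ^ 2` is a primitive Pythagorean triple with `x = w ^ 2` odd, then
`x` and `y` can be expressed by two coprime odd numbers. -/
theorem Int.exists_of_sq_eq_pow_four_add_sq {w y z : ℤ} (hw : w % 2 = 1) (hz : 0 < z)
    (hwy : IsCoprime w y) (h : w ^ 4 + y ^ 2 = z ^ 2) :
    ∃ g k : ℤ, 0 < g ∧ 0 < k ∧ IsCoprime g k ∧ g * k = |w| ∧ 2 * y = g ^ 4 - k ^ 4 := by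
  have hw8 := Int.sq_emod_eight_of_odd hw
  obtain ⟨s, t, hx, hy, hz', hst, hpar, hs⟩ := PythagoreanTriple.coprime_classification'
    (x := w ^ 2) (y := y) (z := z) (by unfold PythagoreanTriple; linear_combination h)
    (Int.isCoprime_iff_gcd_eq_one.1 hwy.pow_left) (by omega) hz
  have hmul : (s + t) * (s - t) = w ^ 2 := by rw [hx]; ring
  have hw0 : 0 < w ^ 2 := by
    have : w ≠ 0 := by rintro rfl; omega
    positivity
  have hs0 : 0 < s := by
    rcases eq_or_lt_of_le hs with rfl | h
    · nlinarith [sq_nonneg t]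
    · exact h
  obtain ⟨h1, h2⟩ := Int.nonneg_and_nonneg_of_mul_nonneg_of_add_pos (x := s + t) (y := s - t)
    (by rw [hmul]; exact hw0.le) (by linarith)
  have h1' : s + t ≠ 0 := by intro h; rw [h, zero_mul] at hmul; omega
  have h2' : s - t ≠ 0 := by intro h; rw [h, mul_zero] at hmul; omega
  have hcop : IsCoprime (s + t) (s - t) := by
    have hst := Int.isCoprime_iff_gcd_eq_one.2 hst
    refine Int.isCoprime_of_forall_prime fun p hp hpu hpv => ?_
    have h3 : p ∣ 2 * s := by rw [show 2 * s = s + t + (s - t) by ring]; exact dvd_add hpu hpv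
    have h4 : p ∣ 2 * t := by rw [show 2 * t = s + t - (s - t) by ring]; exact dvd_sub hpu hpv
    rcases hp.dvd_or_dvd h3 with h5 | h5
    · have : (2 : ℤ) ∣ s + t :=
          ((hp.associated_of_dvd Int.prime_two h5).dvd_iff_dvd_left).1 hpu
      omega
    · rcases hp.dvd_or_dvd h4 with h6 | h6
      · have : (2 : ℤ) ∣ s + t :=
          ((hp.associated_of_dvd Int.prime_two h6).dvd_iff_dvd_left).1 hpu
        omega
      · exact hp.not_isUnit (hst.isUnit_of_dvd' h5 h6)
  obtain ⟨g, k, hg, hk, hg', hk', hgk⟩ :=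
    Int.exists_sq_of_mul_eq_sq hcop (by omega) (by omega) hmul
  refine ⟨g, k, hg, hk, ?_, hgk, ?_⟩
  · rw [hg', hk'] at hcop
    exact (IsCoprime.pow_iff two_pos two_pos).1 hcop
  · rw [hy, show g ^ 4 = (g ^ 2) ^ 2 by ring, show k ^ 4 = (k ^ 2) ^ 2 by ring, ← hg', ← hk']
    ring

/-- If `x ^ 2 + (2 * w ^ 2) ^ 2 = z ^ 2` is a primitive Pythagorean triple, then
`x` and `w` can be expressed by two coprime numbers. -/
theorem Int.exists_of_sq_eq_sq_add_four_mul_pow_four {w x z : ℤ} (hx : x % 2 = 1) (hz : 0 < z)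
    (hw : w ≠ 0) (hwx : IsCoprime w x) (h : x ^ 2 + 4 * w ^ 4 = z ^ 2) :
    ∃ g k : ℤ, 0 < g ∧ 0 < k ∧ IsCoprime g k ∧ g * k = |w| ∧ x = g ^ 4 - k ^ 4 := by
  have h2x : IsCoprime 2 x := ⟨-(x / 2), 1, by omega⟩
  obtain ⟨s, t, hx, hy, hz', hst, hpar, hs⟩ := PythagoreanTriple.coprime_classification'
    (x := x) (y := 2 * w ^ 2) (z := z) (by unfold PythagoreanTriple; linear_combination h)
    (Int.isCoprime_iff_gcd_eq_one.1 (h2x.mul_left hwx.pow_left).symm) hx hz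
  have hmul : s * t = w ^ 2 := by linarith
  have hw0 : 0 < w ^ 2 := by positivity
  have hs0 : 0 < s := by
    rcases eq_or_lt_of_le hs with rfl | h
    · omega
    · exact h
  have ht0 : 0 < t := by nlinarith
  obtain ⟨g, k, hg, hk, rfl, rfl, hgk⟩ :=
    Int.exists_sq_of_mul_eq_sq (Int.isCoprime_iff_gcd_eq_one.2 hst) hs0 ht0 hmul
  exact ⟨g, k, hg, hk, (IsCoprime.pow_iff two_pos two_pos).1 (Int.isCoprime_iff_gcd_eq_one.2 hst),
    hgk, by rw [hx]; ring⟩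

set_option maxHeartbeats 1000000 in
theorem Int.quartic_one_aux (n : ℕ) : ∀ g h w : ℤ, IsCoprime g h → 0 < g → 0 < h → h < n →
    g ^ 4 + g ^ 2 * h ^ 2 - h ^ 4 = w ^ 2 → g = 1 ∧ h = 1 := by
  induction n with
  | zero => intro M e N _ _ h h'; simp at h'; omega
  | succ n ih =>
  intro g h w hgh hg hh hhn heq
  have h5 : Prime (5 : ℤ) := Int.prime_iff_natAbs_prime.2 (by norm_num)
  rcases Int.emod_two_eq_zero_or_one h with hh2 | hh2
  · exfalso
    obtain ⟨f, rfl⟩ : ∃ f, h = 2 * f := ⟨h / 2, by omega⟩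
    have hf : 0 < f := by omega
    have hg2 : g % 2 = 1 := by
      by_contra hM
      have := hgh.isUnit_of_dvd' (x := 2) (by omega) (by omega)
      exact absurd this (by decide)
    have hg8 := Int.sq_emod_eight_of_odd hg2
    have hg4 := Int.pow_four_emod_sixteen_of_odd hg2
    have hgf : IsCoprime g f := hgh.of_mul_right_right
    have hw2 : w % 2 = 1 := by
      rcases Int.emod_two_eq_zero_or_one w with h2 | h2
      · obtain ⟨m, rfl⟩ : ∃ f, w = 2 * f := ⟨w / 2, by omega⟩
        ring_nf at heq
        omega
      · exact h2
    obtain ⟨u, hu⟩ : ∃ u, g ^ 2 + 2 * f ^ 2 - w = 2 * u := ⟨(g ^ 2 + 2 * f ^ 2 - w) / 2, by omega⟩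
    obtain ⟨v, hv⟩ : ∃ v, g ^ 2 + 2 * f ^ 2 + w = 2 * v := ⟨(g ^ 2 + 2 * f ^ 2 + w) / 2, by omega⟩
    have huv : u * v = 5 ^ 1 * f ^ 4 := by
      have : (2 * u) * (2 * v) = 4 * (5 ^ 1 * f ^ 4) := by
        rw [← hu, ← hv]; linear_combination heq
      linarith
    have hcop : IsCoprime u v := by
      refine Int.isCoprime_of_forall_prime fun p hp hpu hpv => ?_
      have hpf := Int.dvd_of_sq_dvd_squarefree_mul_pow Int.squarefree_five hp hpu hpv
        (by simpa using huv)
      have : p ∣ g ^ 2 := by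
        rw [show g ^ 2 = u + v - 2 * f ^ 2 by linarith]
        exact dvd_sub (dvd_add hpu hpv) ((hpf.pow two_ne_zero).mul_left _)
      exact hp.not_isUnit (hgf.isUnit_of_dvd' (hp.dvd_of_dvd_pow this) hpf)
    obtain ⟨hu0, hv0⟩ := Int.nonneg_and_nonneg_of_mul_nonneg_of_add_pos (x := u) (y := v)
      (by rw [huv]; positivity) (by nlinarith)
    obtain ⟨b, a, hb, ha, hab, hcop2, h3⟩ :=
      Int.exists_of_mul_eq_prime_pow_mul_pow_four 1 h5 (by norm_num) hcop hf.le hu0 hv0 huv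
    subst hab
    have ha0 : 0 < a := pos_of_mul_pos_right hf hb
    have hb0 : 0 < b := pos_of_mul_pos_left hf ha
    have hsum : u + v = g ^ 2 + 2 * (b * a) ^ 2 := by linarith
    have hg : (b ^ 2 - a ^ 2) ^ 2 + 4 * a ^ 4 = g ^ 2 := by
      rcases h3 with ⟨h3, h4⟩ | ⟨h3, h4⟩ <;> linear_combination hsum - h3 - h4
    have hodd : (b ^ 2 - a ^ 2) % 2 = 1 := by
      rcases Int.emod_two_eq_zero_or_one (b ^ 2 - a ^ 2) with h2 | h2
      · obtain ⟨m, hm⟩ : ∃ m, b ^ 2 - a ^ 2 = 2 * m := ⟨(b ^ 2 - a ^ 2) / 2, by omega⟩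
        rw [hm] at hg
        ring_nf at hg
        omega
      · exact h2
    have hcop3 : IsCoprime a (b ^ 2 - a ^ 2) := by
      have := (hcop2.pow_left (m := 2)).symm.add_mul_left_right (-a)
      rwa [show b ^ 2 + a * -a = b ^ 2 - a ^ 2 by ring] at this
    obtain ⟨g', k, hg', hk, hgk, hw', hx⟩ := Int.exists_of_sq_eq_sq_add_four_mul_pow_four hodd ‹_›
      ha0.ne' hcop3 hg
    rw [abs_of_pos ha0] at hw'
    subst hw'
    have hlt : k < n := by
      have : 1 ≤ b * g' := mul_pos hb0 hg'
      push_cast at hhn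
      nlinarith
    obtain ⟨rfl, rfl⟩ := ih g' k b hgk hg' hk hlt (by linear_combination -hx)
    omega
  · have hh8 := Int.sq_emod_eight_of_odd hh2
    have hh4 := Int.pow_four_emod_sixteen_of_odd hh2
    have hg2 : g % 2 = 1 := by
      rcases Int.emod_two_eq_zero_or_one g with h2 | h2
      · obtain ⟨m, rfl⟩ : ∃ f, g = 2 * f := ⟨g / 2, by omega⟩
        rcases Int.emod_two_eq_zero_or_one w with h2 | h2
        · obtain ⟨x, rfl⟩ : ∃ f, w = 2 * f := ⟨w / 2, by omega⟩
          ring_nf at heq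
          omega
        · have := Int.sq_emod_eight_of_odd h2
          ring_nf at heq
          omega
      · exact h2
    have hg8 := Int.sq_emod_eight_of_odd hg2
    have huv : (2 * g ^ 2 + h ^ 2 - 2 * w) * (2 * g ^ 2 + h ^ 2 + 2 * w) = 5 ^ 1 * h ^ 4 := by
      linear_combination 4 * heq
    have hcop : IsCoprime (2 * g ^ 2 + h ^ 2 - 2 * w) (2 * g ^ 2 + h ^ 2 + 2 * w) := by
      refine Int.isCoprime_of_forall_prime fun p hp hpu hpv => ?_
      have hpf := Int.dvd_of_sq_dvd_squarefree_mul_pow Int.squarefree_five hp hpu hpv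
        (by simpa using huv)
      have : p ∣ 2 ^ 2 * g ^ 2 := by
        rw [show 2 ^ 2 * g ^ 2 = (2 * g ^ 2 + h ^ 2 - 2 * w) + (2 * g ^ 2 + h ^ 2 + 2 * w)
          - 2 * h ^ 2 by ring]
        exact dvd_sub (dvd_add hpu hpv) ((hpf.pow two_ne_zero).mul_left _)
      rcases hp.dvd_or_dvd this with h2 | h2
      · obtain ⟨m, hm⟩ : (2 : ℤ) ∣ h :=
          ((hp.associated_of_dvd Int.prime_two (hp.dvd_of_dvd_pow h2)).dvd_iff_dvd_left).1 hpf
        omega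
      · exact hp.not_isUnit (hgh.isUnit_of_dvd' (hp.dvd_of_dvd_pow h2) hpf)
    obtain ⟨hu0, hv0⟩ := Int.nonneg_and_nonneg_of_mul_nonneg_of_add_pos
      (by rw [huv]; positivity) (by nlinarith)
    obtain ⟨b, a, hb, ha, hab, hcop2, h3⟩ :=
      Int.exists_of_mul_eq_prime_pow_mul_pow_four 1 h5 (by norm_num) hcop hh.le hu0 hv0 huv
    subst hab
    have ha0 : 0 < a := pos_of_mul_pos_right hh hb
    have hb0 : 0 < b := pos_of_mul_pos_left hh ha
    obtain ⟨hb2, ha2⟩ := Int.emod_two_eq_one_of_mul hh2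
    have ha8 := Int.sq_emod_eight_of_odd ha2
    have hb8 := Int.sq_emod_eight_of_odd hb2
    have hg4 : (b ^ 2 - a ^ 2) ^ 2 + 4 * a ^ 4 = 4 * g ^ 2 := by
      rcases h3 with ⟨h3, h4⟩ | ⟨h3, h4⟩ <;> linear_combination - h3 - h4
    obtain ⟨d, hd⟩ : ∃ d, b ^ 2 - a ^ 2 = 2 * d := ⟨(b ^ 2 - a ^ 2) / 2, by omega⟩
    rw [hd] at hg4
    have hcop3 : IsCoprime a d := by
      have := (hcop2.pow_left (m := 2)).symm.add_mul_left_right (-a)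
      rw [show b ^ 2 + a * -a = 2 * d by rw [← hd]; ring] at this
      exact this.of_mul_right_right
    obtain ⟨g', k, hg', hk, hgk, hw', hx⟩ := Int.exists_of_sq_eq_pow_four_add_sq ha2 hg
      hcop3 (by linarith)
    rw [abs_of_pos ha0] at hw'
    subst hw'
    have heq' : g' ^ 4 + g' ^ 2 * k ^ 2 - k ^ 4 = b ^ 2 := by linear_combination -hx - hd
    have hone : g' = 1 ∧ k = 1 := by
      have h1 : 1 ≤ b * g' := mul_pos hb0 hg'
      rcases eq_or_lt_of_le h1 with h1 | h1
      · have hb1 : b = 1 := Int.eq_one_of_mul_eq_one_right hb h1.symm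
        have hg1 : g' = 1 := Int.eq_one_of_mul_eq_one_left hg'.le h1.symm
        subst hb1 hg1
        have : k ^ 2 * (1 - k ^ 2) = 0 := by linear_combination heq'
        have h6 := (mul_eq_zero.1 this).resolve_left (by positivity)
        exact ⟨rfl, (pow_eq_one_iff_of_nonneg hk.le two_ne_zero).1 (by linarith)⟩
      · refine ih g' k b hgk hg' hk ?_ heq'
        push_cast at hhn
        nlinarith
    obtain ⟨rfl, rfl⟩ := hone
    have hb1 : b = 1 := (pow_eq_one_iff_of_nonneg hb two_ne_zero).1 (by linarith)
    subst hb1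
    have hd0 : d = 0 := by linarith
    subst hd0
    exact ⟨(pow_eq_one_iff_of_nonneg hg.le two_ne_zero).1 (by linarith), by norm_num⟩

theorem Int.quartic_one {g h w : ℤ} (hgh : IsCoprime g h) (hg : 0 < g) (hh : 0 < h)
    (heq : g ^ 4 + g ^ 2 * h ^ 2 - h ^ 4 = w ^ 2) : g = 1 ∧ h = 1 :=
  Int.quartic_one_aux (h + 1).toNat g h w hgh hg hh (by simp) heq

theorem Rat.exists_int_of_sq_eq_intCast {r : ℚ} {z : ℤ} (h : r ^ 2 = z) :
    ∃ w : ℤ, r = w ∧ w ^ 2 = z := by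
  obtain ⟨w, hw⟩ := Rat.isSquare_intCast_iff.1 ⟨r, by rw [← h, sq]⟩
  have h1 : r ^ 2 = (w : ℚ) ^ 2 := by rw [h, hw]; push_cast; ring
  rcases sq_eq_sq_iff_eq_or_eq_neg.1 h1 with h2 | h2
  · exact ⟨w, h2, by rw [hw, sq]⟩
  · exact ⟨-w, by rw [h2]; push_cast; rfl, by rw [hw]; ring⟩

theorem Rat.exists_eq_div_isCoprime (q : ℚ) :
    ∃ m n : ℤ, 0 < n ∧ IsCoprime m n ∧ q = m / n :=
  ⟨q.num, q.den, by exact_mod_cast q.den_pos, q.isCoprime_num_den, by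
    rw [Int.cast_natCast]; exact (Rat.num_div_den q).symm⟩

/-- The rational points on `q⁴ + 4 (q + 1)² = y²`. -/
theorem Rat.eq_zero_or_eq_neg_one_of_sq_eq {q y : ℚ} (h : q ^ 4 + 4 * (q + 1) ^ 2 = y ^ 2) :
    q = 0 ∨ q = -1 := by
  obtain ⟨m, n, hn, hcop, rfl⟩ := q.exists_eq_div_isCoprime
  have hn' : (n : ℚ) ≠ 0 := by exact_mod_cast hn.ne'
  obtain ⟨Y, -, hY⟩ := Rat.exists_int_of_sq_eq_intCast (r := y * n ^ 2)
    (z := m ^ 4 + 4 * n ^ 2 * (m + n) ^ 2) (by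
      push_cast
      rw [mul_pow, ← h]
      field_simp)
  by_cases hm : m = 0
  · left; simp [hm]
  rcases Int.emod_two_eq_zero_or_one m with hm2 | hm2
  · exfalso
    obtain ⟨k, rfl⟩ : ∃ k, m = 2 * k := ⟨m / 2, by omega⟩
    have hk0 : k ≠ 0 := by rintro rfl; exact hm rfl
    have hn2 : n % 2 = 1 := by
      by_contra hM
      have := hcop.isUnit_of_dvd' (x := 2) (by omega) (by omega)
      exact absurd this (by decide)
    have hY2 : Y % 2 = 0 := by
      by_contra h2
      have := Int.sq_emod_eight_of_odd (x := Y) (by omega)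
      ring_nf at hY
      omega
    obtain ⟨Z, rfl⟩ : ∃ k, Y = 2 * k := ⟨Y / 2, by omega⟩
    have hkn : IsCoprime k n := hcop.of_mul_left_right
    have hodd : (n * (2 * k + n)) % 2 = 1 := by simp [Int.mul_emod, Int.add_emod, hn2]
    have hZ0 : Z ≠ 0 := by
      rintro rfl
      have : 0 < k ^ 4 := by positivity
      nlinarith [sq_nonneg (n * (2 * k + n))]
    obtain ⟨g, t, hg, ht, hgt, hgk, hx⟩ := Int.exists_of_sq_eq_sq_add_four_mul_pow_four
      (w := k) (z := |Z|) hodd (abs_pos.2 hZ0) hk0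
      (hkn.mul_right (by simpa using (hkn.mul_add_right_right 2)))
      (by rw [sq_abs]; linarith)
    have hgk2 : g ^ 2 * t ^ 2 = k ^ 2 := by rw [← mul_pow, hgk, sq_abs]
    obtain ⟨rfl, rfl⟩ := Int.quartic_one hgt hg ht (w := n + k) (by linear_combination hgk2 - hx)
    rw [hx] at hodd
    norm_num at hodd
  · have hY0 : Y ≠ 0 := by
      rintro rfl
      have : 0 < m ^ 4 := by positivity
      nlinarith [sq_nonneg (n * (m + n))]
    have h2m : IsCoprime m 2 := ⟨1, -(m / 2), by omega⟩
    obtain ⟨g, t, hg, ht, hgt, hgk, hx⟩ := Int.exists_of_sq_eq_pow_four_add_sq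
      (y := 2 * (n * (m + n))) (z := |Y|) hm2 (abs_pos.2 hY0)
      (h2m.mul_right (hcop.mul_right (by simpa using (hcop.mul_add_right_right 1))))
      (by rw [sq_abs]; linarith)
    have hgk2 : g ^ 2 * t ^ 2 = m ^ 2 := by rw [← mul_pow, hgk, sq_abs]
    obtain ⟨rfl, rfl⟩ := Int.quartic_one hgt hg ht (w := 2 * n + m)
      (by linear_combination hgk2 - hx)
    have h0 : n * (m + n) = 0 := by linarith
    have : m = -n := by linarith [(mul_eq_zero.1 h0).resolve_left hn.ne']
    right
    rw [this]
    push_cast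
    field_simp

theorem Int.exists_eq_sq_of_mul_eq_sq {u v w : ℤ} (h : IsCoprime u v) (hu : 0 < u)
    (huv : u * v = w ^ 2) : ∃ a : ℤ, u = a ^ 2 := by
  obtain ⟨d, hd⟩ := exists_associated_pow_of_mul_eq_pow' h huv
  refine ⟨d, ?_⟩
  rcases Int.associated_iff.1 hd with h1 | h1
  · exact h1.symm
  · nlinarith [sq_nonneg d]

theorem Int.exists_eq_sq_or_two_mul_sq {m Q w : ℤ} (hm : 0 < m)
    (h : ∀ p : ℤ, Prime p → p ∣ m → p ∣ Q → p ∣ 2) (hw : m * Q = w ^ 2) :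
    ∃ a : ℤ, m = a ^ 2 ∨ m = 2 * a ^ 2 := by
  obtain ⟨m', hmm, hm'⟩ :=
    (FiniteMultiplicity.of_prime_left Int.prime_two hm.ne').exists_eq_pow_mul_and_not_dvd
  generalize multiplicity 2 m = i at hmm
  subst hmm
  have h1 : IsCoprime m' (2 ^ i * Q) := by
    refine Int.isCoprime_of_forall_prime fun p hp hpm hpq => ?_
    have h2 : p ∣ 2 := by
      rcases hp.dvd_or_dvd hpq with h2 | h2
      · exact hp.dvd_of_dvd_pow h2
      · exact h p hp (hpm.mul_left _) h2
    exact hm' (((hp.associated_of_dvd Int.prime_two h2).dvd_iff_dvd_left).1 hpm)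
  obtain ⟨a, rfl⟩ := Int.exists_eq_sq_of_mul_eq_sq h1 (pos_of_mul_pos_right hm (by positivity))
    (w := w) (by rw [← hw]; ring)
  rcases Nat.even_or_odd' i with ⟨k, rfl | rfl⟩
  · exact ⟨2 ^ k * a, Or.inl (by ring)⟩
  · exact ⟨2 ^ k * a, Or.inr (by ring)⟩

theorem Rat.exists_eq_sq_or_two_mul_sq {X y : ℚ} {p : ℤ} {k : ℕ} (hX : 0 < X)
    (h : X * (X ^ 2 + p * X + 2 ^ k) = y ^ 2) : ∃ g : ℚ, X = g ^ 2 ∨ X = 2 * g ^ 2 := by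
  obtain ⟨m, n, hn, hcop, rfl⟩ := X.exists_eq_div_isCoprime
  have hn' : (n : ℚ) ≠ 0 := by exact_mod_cast hn.ne'
  have hn0 : (0 : ℚ) < n := by exact_mod_cast hn
  have hm : 0 < m := by exact_mod_cast (div_pos_iff_of_pos_right hn0).1 hX
  obtain ⟨Y, -, hY⟩ := Rat.exists_int_of_sq_eq_intCast (r := y * n ^ 2)
    (z := n * (m * (m ^ 2 + p * m * n + 2 ^ k * n ^ 2))) (by
      push_cast
      rw [mul_pow, ← h]
      field_simp)
  have hnQ : IsCoprime n (m ^ 2 + p * m * n + 2 ^ k * n ^ 2) := by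
    have := (hcop.pow_left (m := 2)).symm.add_mul_left_right (p * m + 2 ^ k * n)
    rwa [show m ^ 2 + n * (p * m + 2 ^ k * n) = m ^ 2 + p * m * n + 2 ^ k * n ^ 2 by ring] at this
  obtain ⟨c, rfl⟩ := Int.exists_eq_sq_of_mul_eq_sq (hcop.symm.mul_right hnQ) hn hY.symm
  have hc : c ≠ 0 := by rintro rfl; simp at hn
  obtain ⟨d, rfl⟩ : c ∣ Y := by
    rw [← Int.pow_dvd_pow_iff two_ne_zero, hY]
    exact Dvd.intro _ rfl
  obtain ⟨a, ha⟩ := Int.exists_eq_sq_or_two_mul_sq (m := m)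
      (Q := m ^ 2 + p * m * c ^ 2 + 2 ^ k * (c ^ 2) ^ 2) (w := d) hm (by
    intro q hq h1 h2
    have h3 : q ∣ 2 ^ k * (c ^ 2) ^ 2 := by
      rw [show 2 ^ k * (c ^ 2) ^ 2 = m ^ 2 + p * m * c ^ 2 + 2 ^ k * (c ^ 2) ^ 2
        - m * (m + p * c ^ 2) by ring]
      exact dvd_sub h2 (h1.mul_right _)
    rcases hq.dvd_or_dvd h3 with h4 | h4
    · exact hq.dvd_of_dvd_pow h4
    · exact absurd (hcop.isUnit_of_dvd' h1 (hq.dvd_of_dvd_pow h4)) hq.not_isUnit)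
    (mul_left_cancel₀ (pow_ne_zero 2 hc) (by rw [← hY]; ring))
  refine ⟨a / c, ?_⟩
  rcases ha with rfl | rfl
  · left; push_cast; field_simp
  · right; push_cast; field_simp

theorem Rat.sq_eq_four_of_quartic_eleven {t w : ℚ} (h : t ^ 4 - 11 * t ^ 2 + 32 = w ^ 2) :
    t ^ 2 = 4 := by
  obtain ⟨m, n, hn, hcop, rfl⟩ := t.exists_eq_div_isCoprime
  have hn' : (n : ℚ) ≠ 0 := by exact_mod_cast hn.ne'
  obtain ⟨Y, -, hY⟩ := Rat.exists_int_of_sq_eq_intCast (r := w * n ^ 2)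
    (z := m ^ 4 - 11 * m ^ 2 * n ^ 2 + 32 * n ^ 4) (by
      push_cast
      rw [mul_pow, ← h]
      field_simp)
  obtain ⟨h1, h2⟩ := Int.quartic_eleven hcop hn.ne' hY.symm
  rw [div_pow]
  norm_cast
  rw [h1, h2]
  norm_num

theorem Rat.sq_eq_four_of_quartic_thirteen {t w : ℚ} (h : t ^ 4 + 13 * t ^ 2 + 128 = w ^ 2) :
    t ^ 2 = 4 := by
  obtain ⟨m, n, hn, hcop, rfl⟩ := t.exists_eq_div_isCoprime
  have hn' : (n : ℚ) ≠ 0 := by exact_mod_cast hn.ne'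
  obtain ⟨Y, -, hY⟩ := Rat.exists_int_of_sq_eq_intCast (r := w * n ^ 2)
    (z := m ^ 4 + 13 * m ^ 2 * n ^ 2 + 128 * n ^ 4) (by
      push_cast
      rw [mul_pow, ← h]
      field_simp)
  obtain ⟨h1, h2⟩ := Int.quartic_thirteen hcop hn.ne' hY.symm
  rw [div_pow]
  norm_cast
  rw [h1, h2]
  norm_num

/-- The affine rational points of the elliptic curve `y² = (x + 7) (x² + 3 x + 4)`. -/
theorem Rat.eq_of_elliptic_eleven {x y : ℚ} (h : (x + 7) * (x ^ 2 + 3 * x + 4) = y ^ 2) :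
    x = -7 ∨ x = 1 ∨ x = -3 := by
  obtain ⟨X, rfl⟩ : ∃ X, x = X - 7 := ⟨x + 7, by ring⟩
  have h : X * (X ^ 2 + ((-11 : ℤ) : ℚ) * X + 2 ^ 5) = y ^ 2 := by
    rw [← h]; push_cast; ring
  rcases eq_or_ne X 0 with rfl | hX0
  · left; ring
  have hX : 0 < X := by
    push_cast at h
    have h1 : 0 < X ^ 2 + (-11) * X + 2 ^ 5 := by nlinarith [sq_nonneg (X - 11 / 2)]
    exact lt_of_le_of_ne (nonneg_of_mul_nonneg_left (h ▸ sq_nonneg y) h1) hX0.symm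
  obtain ⟨g, rfl | rfl⟩ := Rat.exists_eq_sq_or_two_mul_sq hX h
  · have hg : g ≠ 0 := by rintro rfl; simp at hX0
    rw [Rat.sq_eq_four_of_quartic_eleven (t := g) (w := y / g)
      (by rw [div_pow, ← h]; field_simp; push_cast; ring)]
    right; right; norm_num
  · have hg : g ≠ 0 := by rintro rfl; simp at hX0
    have := Rat.sq_eq_four_of_quartic_eleven (t := 4 / g) (w := 2 * y / g ^ 3)
      (by rw [div_pow _ (g ^ 3), mul_pow, ← h]; field_simp; push_cast; ring)
    have : g ^ 2 = 4 := by field_simp at this; linarith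
    rw [this]
    right; left; norm_num

/-- The affine rational points of the elliptic curve `w² = (1 + 7 z) (1 + 3 z + 4 z²)`. -/
theorem Rat.eq_of_elliptic_thirteen {z w : ℚ} (h : (1 + 7 * z) * (1 + 3 * z + 4 * z ^ 2) = w ^ 2) :
    z = -1 / 7 ∨ z = 0 ∨ z = 1 := by
  obtain ⟨X, rfl⟩ : ∃ X, z = (X - 4) / 28 := ⟨28 * z + 4, by ring⟩
  have h : X * (X ^ 2 + ((13 : ℤ) : ℚ) * X + 2 ^ 7) = (28 * w) ^ 2 := by
    rw [mul_pow, ← h]; push_cast; ring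
  rcases eq_or_ne X 0 with rfl | hX0
  · left; norm_num
  have hX : 0 < X := by
    push_cast at h
    have h1 : 0 < X ^ 2 + 13 * X + 2 ^ 7 := by nlinarith [sq_nonneg (X + 13 / 2)]
    exact lt_of_le_of_ne (nonneg_of_mul_nonneg_left (h ▸ sq_nonneg _) h1) hX0.symm
  obtain ⟨g, rfl | rfl⟩ := Rat.exists_eq_sq_or_two_mul_sq hX h
  · have hg : g ≠ 0 := by rintro rfl; simp at hX0
    rw [Rat.sq_eq_four_of_quartic_thirteen (t := g) (w := 28 * w / g)
      (by rw [div_pow, ← h]; field_simp; push_cast; ring)]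
    right; left; norm_num
  · have hg : g ≠ 0 := by rintro rfl; simp at hX0
    have := Rat.sq_eq_four_of_quartic_thirteen (t := 8 / g) (w := 4 * (28 * w) / g ^ 3)
      (by rw [div_pow _ (g ^ 3), mul_pow, ← h]; field_simp; push_cast; ring)
    have : g ^ 2 = 16 := by field_simp at this; linarith
    rw [this]
    right; right; norm_num

open NumberField in
/-- If `n² + 3 m²` is an odd cube prime to `3` with `n`, `m` coprime, then `n + m √-3` is a cube. -/
theorem Int.exists_of_sq_add_three_mul_sq_eq_cube {n m B : ℤ} (hnm : IsCoprime n m)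
    (hodd : (n + m) % 2 = 1) (h3 : ¬ 3 ∣ n) (h : n ^ 2 + 3 * m ^ 2 = B ^ 3) :
    ∃ r s : ℤ, n = r * (r ^ 2 - 9 * s ^ 2) ∧ m = 3 * s * (r ^ 2 - s ^ 2) := by
  obtain ⟨K, _, _, _⟩ : ∃ (K : Type) (_ : Field K) (_ : NumberField K),
      IsCyclotomicExtension {3} ℚ K :=
    ⟨CyclotomicField 3 ℚ, inferInstance, inferInstance, by
      convert CyclotomicField.isCyclotomicExtension 3 ℚ
      · rfl
      · exact Subsingleton.elim _ _⟩
  have hζ : IsPrimitiveRoot (IsCyclotomicExtension.zeta 3 ℚ K) 3 :=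
    IsCyclotomicExtension.zeta_spec 3 ℚ K
  have : IsPrincipalIdealRing (𝓞 K) := IsCyclotomicExtension.Rat.three_pid K
  obtain ⟨η, hη⟩ : ∃ η : 𝓞 K, η = hζ.toInteger := ⟨_, rfl⟩
  have hη2 : η ^ 2 = -η - 1 := by
    rw [hη]; exact IsCyclotomicExtension.Rat.Three.eta_sq hζ
  -- coordinates
  have hcoord : ∀ z : 𝓞 K, ∃ x y : ℤ, z = x + y * η := by
    intro z
    obtain ⟨f, hf, hz⟩ := hζ.integralPowerBasis.exists_eq_aeval z
    rw [hζ.integralPowerBasis_dim, show Nat.totient 3 = 2 from rfl] at hf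
    rw [hζ.integralPowerBasis_gen, ← hη] at hz
    obtain ⟨a, b, rfl⟩ := Polynomial.exists_eq_X_add_C_of_natDegree_le_one (Nat.lt_succ_iff.1 hf)
    exact ⟨b, a, by rw [hz]; simp [add_comm]⟩
  have hindep : ∀ a b a' b' : ℤ, (a + b * η : 𝓞 K) = a' + b' * η → a = a' ∧ b = b' := by
    intro a b a' b' he
    have h1 : (((a - a') ^ 2 - (a - a') * (b - b') + (b - b') ^ 2 : ℤ) : 𝓞 K) = 0 := by
      push_cast
      linear_combination (a - a' - (b - b') - (b - b') * η) * he + (b - b') ^ 2 * hη2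
    have h1 := Int.cast_eq_zero.1 h1
    constructor <;> nlinarith [sq_nonneg (a - a' - (b - b')), sq_nonneg (a - a'), sq_nonneg (b - b')]
  have hcop2 : IsCoprime (2 * n) (B ^ 3) := by
    rw [← h]
    refine Int.isCoprime_of_forall_prime fun p hp h1 h2 => ?_
    rcases hp.dvd_or_dvd h1 with h4 | h4
    · obtain ⟨k, hk⟩ := ((hp.associated_of_dvd Int.prime_two h4).dvd_iff_dvd_left).1 h2
      rcases Int.emod_two_eq_zero_or_one n with h5 | h5
      · obtain ⟨x, rfl⟩ : ∃ x, n = 2 * x := ⟨n / 2, by omega⟩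
        have := Int.sq_emod_eight_of_odd (x := m) (by omega)
        ring_nf at hk
        omega
      · obtain ⟨x, rfl⟩ : ∃ x, m = 2 * x := ⟨m / 2, by omega⟩
        have := Int.sq_emod_eight_of_odd h5
        ring_nf at hk
        omega
    · have h5 : p ∣ 3 * m ^ 2 := (dvd_add_right (h4.pow two_ne_zero)).1 h2
      rcases hp.dvd_or_dvd h5 with h6 | h6
      · exact h3 (((hp.associated_of_dvd Int.prime_three h6).dvd_iff_dvd_left).1 h4)
      · exact hp.not_isUnit (hnm.isUnit_of_dvd' h4 (hp.dvd_of_dvd_pow h6))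
  have hmul : ((n + m : ℤ) + (2 * m : ℤ) * η : 𝓞 K) * ((n - m : ℤ) - (2 * m : ℤ) * η) = B ^ 3 := by
    have := congrArg (Int.cast : ℤ → 𝓞 K) h
    push_cast at this ⊢
    rw [← this]
    linear_combination -4 * m ^ 2 * hη2
  have hcop : IsCoprime ((n + m : ℤ) + (2 * m : ℤ) * η : 𝓞 K) ((n - m : ℤ) - (2 * m : ℤ) * η) := by
    obtain ⟨u, v, huv⟩ := hcop2
    have huv := congrArg (Int.cast : ℤ → 𝓞 K) huv
    push_cast at huv
    rw [← hmul] at huv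
    refine ⟨u + v * ((n - m : ℤ) - (2 * m : ℤ) * η), u, ?_⟩
    rw [← huv]
    push_cast
    ring
  obtain ⟨β, w, hw⟩ := exists_associated_pow_of_mul_eq_pow' hcop hmul
  -- after multiplying by a cube root of unity, `β = x + 2 s η`
  obtain ⟨x, s, hβ⟩ : ∃ x s : ℤ, β ^ 3 = (x + (2 * s : ℤ) * η) ^ 3 := by
    have hη3 : η ^ 3 = 1 := by linear_combination (η - 1) * hη2
    obtain ⟨x, y, rfl⟩ := hcoord β
    by_cases hy : y % 2 = 0
    · exact ⟨x, y / 2, by rw [show 2 * (y / 2) = y by omega]⟩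
    by_cases hx : x % 2 = 0
    · refine ⟨y - x, -(x / 2), ?_⟩
      rw [show 2 * -(x / 2) = -x by omega]
      push_cast
      rw [show (y - x + -x * η : 𝓞 K) = (x + y * η) * η ^ 2 by
        linear_combination (-x - y * (η - 1)) * hη2]
      rw [mul_pow, ← pow_mul, pow_mul' η 2 3, hη3]; ring
    · refine ⟨-y, (x - y) / 2, ?_⟩
      rw [show 2 * ((x - y) / 2) = x - y by omega]
      push_cast
      rw [show (-y + (x - y) * η : 𝓞 K) = (x + y * η) * η by linear_combination -y * hη2]
      rw [mul_pow, hη3]; ring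
  have hcube : (β ^ 3 : 𝓞 K) = ((x ^ 3 + 8 * s ^ 3 - 12 * x * s ^ 2 : ℤ) : 𝓞 K) +
      ((6 * x * s * (x - 2 * s) : ℤ) : 𝓞 K) * η := by
    rw [hβ]
    push_cast
    linear_combination (12 * x * s ^ 2 + 8 * s ^ 3 * (η - 1)) * hη2
  rw [hcube] at hw
  have hfin : ∀ x s : ℤ, n + m = x ^ 3 + 8 * s ^ 3 - 12 * x * s ^ 2 →
      2 * m = 6 * x * s * (x - 2 * s) →
      ∃ r s : ℤ, n = r * (r ^ 2 - 9 * s ^ 2) ∧ m = 3 * s * (r ^ 2 - s ^ 2) := by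
    intro x s h1 h2
    have h2 : m = 3 * x * s * (x - 2 * s) := by linarith
    exact ⟨x - s, s, by linear_combination h1 - h2, by rw [h2]; ring⟩
  have hu := IsCyclotomicExtension.Rat.Three.Units.mem hζ w
  simp only [List.mem_cons, List.not_mem_nil, or_false] at hu
  have hbase : ∀ a b : ℤ, (n + m) ≠ 2 * a + 2 * b := by intro a b; omega
  have hval : (w : 𝓞 K) = 1 ∨ (w : 𝓞 K) = -1 ∨ (w : 𝓞 K) = η ∨ (w : 𝓞 K) = -η ∨
      (w : 𝓞 K) = η ^ 2 ∨ (w : 𝓞 K) = -η ^ 2 := by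
    rcases hu with rfl | rfl | rfl | rfl | rfl | rfl <;> simp [hη]
  rcases hval with h1 | h1 | h1 | h1 | h1 | h1 <;> rw [h1] at hw
  · obtain ⟨h4, h5⟩ := hindep _ _ _ _ ((mul_one _).symm.trans hw)
    exact hfin x s h4.symm h5.symm
  · obtain ⟨h4, h5⟩ := hindep (-(x ^ 3 + 8 * s ^ 3 - 12 * x * s ^ 2)) (-(6 * x * s * (x - 2 * s)))
      _ _ (by rw [← hw]; push_cast; ring)
    exact hfin (-x) (-s) (by rw [← h4]; ring) (by rw [← h5]; ring)
  all_goals exfalso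
  · obtain ⟨h4, h5⟩ := hindep (-(6 * x * s * (x - 2 * s)))
      (x ^ 3 + 8 * s ^ 3 - 12 * x * s ^ 2 - (6 * x * s * (x - 2 * s)))
      _ _ (by rw [← hw]; push_cast; linear_combination - (6 * x * s * (x - 2 * s)) * hη2)
    exact hbase (-(3 * x * s * (x - 2 * s))) 0 (by rw [← h4]; ring)
  · obtain ⟨h4, h5⟩ := hindep (6 * x * s * (x - 2 * s))
      (-(x ^ 3 + 8 * s ^ 3 - 12 * x * s ^ 2 - (6 * x * s * (x - 2 * s))))
      _ _ (by rw [← hw]; push_cast; linear_combination (6 * x * s * (x - 2 * s)) * hη2)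
    exact hbase (3 * x * s * (x - 2 * s)) 0 (by rw [← h4]; ring)
  · obtain ⟨h4, h5⟩ := hindep
      (6 * x * s * (x - 2 * s) - (x ^ 3 + 8 * s ^ 3 - 12 * x * s ^ 2))
      (-(x ^ 3 + 8 * s ^ 3 - 12 * x * s ^ 2))
      _ _ (by
        rw [← hw]; push_cast
        linear_combination (-(x ^ 3 + 8 * s ^ 3 - 12 * x * s ^ 2) -
          (6 * x * s * (x - 2 * s)) * (η - 1)) * hη2)
    exact hbase (3 * x * s * (x - 2 * s)) m (by linarith)
  · obtain ⟨h4, h5⟩ := hindep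
      (-(6 * x * s * (x - 2 * s) - (x ^ 3 + 8 * s ^ 3 - 12 * x * s ^ 2)))
      (x ^ 3 + 8 * s ^ 3 - 12 * x * s ^ 2)
      _ _ (by
        rw [← hw]; push_cast
        linear_combination (x ^ 3 + 8 * s ^ 3 - 12 * x * s ^ 2 +
          (6 * x * s * (x - 2 * s)) * (η - 1)) * hη2)
    exact hbase (-(3 * x * s * (x - 2 * s))) m (by linarith)

theorem Int.eq_cube_of_mul_mul_eq_cube {p q r v : ℤ} (hpq : IsCoprime p q) (hpr : IsCoprime p r)
    (hqr : IsCoprime q r) (h : p * q * r = v ^ 3) :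
    ∃ a b c : ℤ, p = a ^ 3 ∧ q = b ^ 3 ∧ r = c ^ 3 := by
  have h3 : Odd 3 := by decide
  obtain ⟨a, ha⟩ := Int.eq_pow_of_mul_eq_pow_odd_left (c := v) (hpq.mul_right hpr) h3
    (by rw [← h]; ring)
  obtain ⟨b, hb⟩ := Int.eq_pow_of_mul_eq_pow_odd_left (c := v) (hpq.symm.mul_right hqr) h3
    (by rw [← h]; ring)
  obtain ⟨c, hc⟩ := Int.eq_pow_of_mul_eq_pow_odd_left (c := v) (hpr.symm.mul_right hqr.symm) h3
    (by rw [← h]; ring)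
  exact ⟨a, b, c, ha, hb, hc⟩

theorem Int.cube_emod_nine (x : ℤ) : (x % 3 = 0 ∧ x ^ 3 % 9 = 0) ∨ (x % 3 = 1 ∧ x ^ 3 % 9 = 1) ∨
    (x % 3 = 2 ∧ x ^ 3 % 9 = 8) := by
  obtain ⟨k, r, hr, hr0, rfl⟩ : ∃ k r : ℤ, r < 3 ∧ 0 ≤ r ∧ x = 3 * k + r :=
    ⟨x / 3, x % 3, by omega, by omega, by omega⟩
  interval_cases r <;> ring_nf <;> omega

/-- The equation `x³ + y³ = 4 z³` has no primitive solution with `z ≠ 0`. -/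
theorem Int.eq_zero_of_cube_add_cube_eq_four_mul_cube {x y z : ℤ} (hxy : IsCoprime x y)
    (h : x ^ 3 + y ^ 3 = 4 * z ^ 3) : z = 0 := by
  induction hN : z.natAbs using Nat.strong_induction_on generalizing x y z with
  | _ N ih =>
  subst hN
  by_contra hz
  have hpar : x % 2 = 1 ∧ y % 2 = 1 := by
    have h1 : (x ^ 3 + y ^ 3) % 2 = 0 := by omega
    rcases Int.emod_two_eq_zero_or_one x with hx | hx <;>
      rcases Int.emod_two_eq_zero_or_one y with hy | hy
    · exact (Int.prime_two.not_isUnit (hxy.isUnit_of_dvd' (Int.dvd_of_emod_eq_zero hx)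
        (Int.dvd_of_emod_eq_zero hy))).elim
    · simp [pow_succ, Int.add_emod, Int.mul_emod, hx, hy] at h1
    · simp [pow_succ, Int.add_emod, Int.mul_emod, hx, hy] at h1
    · exact ⟨hx, hy⟩
  have hmod : z % 3 = 0 ∧ (x + y) % 3 = 0 := by
    have hx := Int.cube_emod_nine x
    have hy := Int.cube_emod_nine y
    have hz := Int.cube_emod_nine z
    omega
  obtain ⟨m, n, rfl, rfl⟩ : ∃ m n, x = 3 * m + n ∧ y = 3 * m - n :=
    ⟨(x + y) / 6, (x - y) / 2, by omega, by omega⟩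
  obtain ⟨w, rfl⟩ : ∃ w, z = 3 * w := ⟨z / 3, by omega⟩
  have hmn : IsCoprime (3 * m) n := by
    refine Int.isCoprime_of_forall_prime fun p hp h1 h2 => hp.not_isUnit ?_
    exact hxy.isUnit_of_dvd' (dvd_add h1 h2) (dvd_sub h1 h2)
  have h1 : m * (n ^ 2 + 3 * m ^ 2) = 6 * w ^ 3 := by linarith
  have hn3 : ¬ 3 ∣ n := fun h3 =>
    Int.prime_three.not_isUnit (hmn.isUnit_of_dvd' (dvd_mul_right _ _) h3)
  have hodd : (n + m) % 2 = 1 := by omega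
  have hm2 : 2 ∣ m := by
    refine (Int.prime_two.dvd_or_dvd (a := m) (b := n ^ 2 + 3 * m ^ 2)
      ⟨3 * w ^ 3, by linarith⟩).resolve_right fun hd => ?_
    rcases Int.emod_two_eq_zero_or_one n with hn | hn <;>
      rcases Int.emod_two_eq_zero_or_one m with hm | hm <;>
      simp [pow_succ, Int.add_emod, Int.mul_emod, hn, hm, Int.dvd_iff_emod_eq_zero] at hd <;> omega
  have hm3 : 3 ∣ m := by
    refine (Int.prime_three.dvd_or_dvd (a := m) (b := n ^ 2 + 3 * m ^ 2)
      ⟨2 * w ^ 3, by linarith⟩).resolve_right fun hd => hn3 ?_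
    exact Int.prime_three.dvd_of_dvd_pow ((dvd_add_left (dvd_mul_right _ _)).1 hd)
  obtain ⟨k, rfl⟩ : ∃ k, m = 6 * k := ⟨m / 6, by omega⟩
  have h2 : k * (n ^ 2 + 3 * (6 * k) ^ 2) = w ^ 3 := by linarith
  have hkn : IsCoprime k n := hmn.of_isCoprime_of_dvd_left ⟨18, by ring⟩
  have hmn' : IsCoprime n (6 * k) := (hmn.of_isCoprime_of_dvd_left ⟨3, by ring⟩).symm
  have hcop : IsCoprime k (n ^ 2 + 3 * (6 * k) ^ 2) := by
    rw [show n ^ 2 + 3 * (6 * k) ^ 2 = n ^ 2 + k * (108 * k) by ring]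
    exact (IsCoprime.pow_right hkn).add_mul_left_right _
  obtain ⟨⟨a, rfl⟩, ⟨B, hB⟩⟩ := Int.eq_pow_of_mul_eq_pow_odd hcop (by decide) h2
  obtain ⟨r, s, hr, hs⟩ := Int.exists_of_sq_add_three_mul_sq_eq_cube hmn' hodd hn3 hB
  have h3 : s * (r ^ 2 - s ^ 2) = 2 * a ^ 3 := by linarith
  have hrs : IsCoprime r s := by
    refine Int.isCoprime_of_forall_prime fun p hp h4 h5 => hp.not_isUnit ?_
    refine hmn'.isUnit_of_dvd' (by rw [hr]; exact h4.mul_right _) ?_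
    rw [hs]; exact (h5.mul_left _).mul_right _
  have hpar' : (r + s) % 2 = 1 := by
    have h4 : (n + 6 * a ^ 3) % 2 = 1 := by omega
    rw [hr, hs] at h4
    rcases Int.emod_two_eq_zero_or_one r with hr | hr <;>
      rcases Int.emod_two_eq_zero_or_one s with hs | hs <;>
      simp [pow_succ, Int.add_emod, Int.sub_emod, Int.mul_emod, hr, hs] at h4 ⊢
  have hs2 : 2 ∣ s := by
    have h4 : (s * (r ^ 2 - s ^ 2)) % 2 = 0 := by omega
    rcases Int.emod_two_eq_zero_or_one r with hr | hr <;>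
      rcases Int.emod_two_eq_zero_or_one s with hs | hs <;>
      simp [pow_succ, Int.sub_emod, Int.mul_emod, hr, hs] at h4 ⊢ <;> omega
  obtain ⟨t, rfl⟩ := hs2
  have h4 : (r - 2 * t) * (r + 2 * t) * t = a ^ 3 := by linarith
  have hrt : IsCoprime r t := hrs.of_isCoprime_of_dvd_right ⟨2, by ring⟩
  have hc1 : IsCoprime (r - 2 * t) (r + 2 * t) := by
    refine Int.isCoprime_of_forall_prime fun p hp h5 h6 => ?_
    have h7 : p ∣ 2 * r := by simpa [two_mul] using dvd_add h5 h6
    have h8 : p ∣ 2 * (2 * t) := by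
      rw [show 2 * (2 * t) = (r + 2 * t) - (r - 2 * t) by ring]; exact dvd_sub h6 h5
    rcases hp.dvd_or_dvd h7 with h9 | h9
    · obtain ⟨x, hx⟩ := ((hp.associated_of_dvd Int.prime_two h9).dvd_iff_dvd_left).1 h6
      omega
    rcases hp.dvd_or_dvd h8 with h10 | h10
    · obtain ⟨x, hx⟩ := ((hp.associated_of_dvd Int.prime_two h10).dvd_iff_dvd_left).1 h6
      omega
    · exact hp.not_isUnit (hrs.isUnit_of_dvd' h9 h10)
  have hc2 : IsCoprime (r - 2 * t) t := by
    have := hrt.add_mul_right_left (-2)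
    rwa [show r + -2 * t = r - 2 * t by ring] at this
  have hc3 : IsCoprime (r + 2 * t) t := hrt.add_mul_right_left 2
  obtain ⟨b, c, d, hb, hc, rfl⟩ := Int.eq_cube_of_mul_mul_eq_cube hc1 hc2 hc3 h4
  have hda : d ∣ a := (Int.pow_dvd_pow_iff three_ne_zero).1 ⟨(r - 2 * d ^ 3) * (r + 2 * d ^ 3), by rw [← h4]; ring⟩
  have haw : a ∣ w := (Int.pow_dvd_pow_iff three_ne_zero).1 ⟨_, h2.symm⟩
  have hw0 : w ≠ 0 := by rintro rfl; simp at hz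
  have hle : d.natAbs ≤ w.natAbs := Int.natAbs_le_of_dvd_ne_zero (hda.trans haw) hw0
  have hd0 : d = 0 := by
    refine ih d.natAbs (by omega) (x := c) (y := -b) ?_ (by linarith) rfl
    rw [hb, hc] at hc1
    exact (IsCoprime.neg_right ((IsCoprime.pow_iff three_pos three_pos).1 hc1.symm))
  rw [hd0, zero_dvd_iff] at hda
  rw [hda, zero_dvd_iff] at haw
  exact hw0 haw

theorem Int.eq_zero_of_mul_mul_add_eq_four_mul_cube {m n v : ℤ} (hmn : IsCoprime m n)
    (h : m * n * (m + n) = 4 * v ^ 3) : v = 0 := by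
  -- of three pairwise coprime factors, the even one is four times a cube
  have key : ∀ {p q r : ℤ}, IsCoprime p q → p + q = r ∨ p - q = r → r % 2 = 0 →
      p * q * r = 4 * v ^ 3 → v = 0 := by
    intro p q r hpq hr hr2 hmul
    have hpr : IsCoprime p r := by
      rcases hr with rfl | rfl
      · simpa [add_comm] using hpq.add_mul_left_right 1
      · have := hpq.neg_right.add_mul_left_right 1
        rwa [show -q + p * 1 = p - q by ring] at this
    have hqr : IsCoprime q r := by
      rcases hr with rfl | rfl
      · simpa using hpq.symm.add_mul_left_right 1
      · have := hpq.symm.add_mul_left_right (-1)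
        rwa [show p + q * -1 = p - q by ring] at this
    have hp2 : p % 2 = 1 := by
      by_contra hp
      exact Int.prime_two.not_isUnit (hpr.isUnit_of_dvd' (by omega) (by omega))
    have hq2 : q % 2 = 1 := by
      by_contra hp
      exact Int.prime_two.not_isUnit (hqr.isUnit_of_dvd' (by omega) (by omega))
    have h4 : 4 ∣ r := by
      have hcop : IsCoprime 4 (p * q) := by
        rw [show (4 : ℤ) = 2 ^ 2 by norm_num]
        refine IsCoprime.pow_left ((Prime.coprime_iff_not_dvd Int.prime_two).2 fun hd => ?_)
        rcases Int.prime_two.dvd_or_dvd hd with hd | hd <;> omega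
      exact hcop.dvd_of_dvd_mul_left ⟨v ^ 3, hmul⟩
    obtain ⟨k, rfl⟩ := h4
    have hpk := hpr.of_isCoprime_of_dvd_right (dvd_mul_left k 4)
    have hqk := hqr.of_isCoprime_of_dvd_right (dvd_mul_left k 4)
    obtain ⟨a, b, c, rfl, rfl, rfl⟩ := Int.eq_cube_of_mul_mul_eq_cube hpq hpk hqk
      (v := v) (by linarith)
    have hab : IsCoprime a b := (IsCoprime.pow_iff three_pos three_pos).1 hpq
    have hc : c = 0 := by
      rcases hr with hr | hr
      · exact Int.eq_zero_of_cube_add_cube_eq_four_mul_cube hab hr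
      · exact Int.eq_zero_of_cube_add_cube_eq_four_mul_cube hab.neg_right (by linarith)
    rw [hc] at hmul
    exact pow_eq_zero_iff three_ne_zero |>.1 (by linarith)
  rcases Int.emod_two_eq_zero_or_one m with hm | hm
  · refine key (p := m + n) (q := n) (r := m) ?_ (Or.inr (by ring)) hm (by linarith)
    simpa using hmn.add_mul_right_left 1
  rcases Int.emod_two_eq_zero_or_one n with hn | hn
  · refine key (p := m + n) (q := m) (r := n) ?_ (Or.inr (by ring)) hn (by linarith)
    simpa [add_comm] using hmn.symm.add_mul_right_left 1
  · exact key hmn (Or.inl rfl) (by omega) h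

/-- The curve `x y (x + y) = 4` has no rational points. -/
theorem Rat.mul_mul_add_ne_four (x y : ℚ) : x * y * (x + y) ≠ 4 := by
  intro h
  have hx : x ≠ 0 := by rintro rfl; norm_num at h
  obtain ⟨m, n, hn, hmn, hq⟩ := Rat.exists_eq_div_isCoprime (y / x)
  have hn0 : (n : ℚ) ≠ 0 := by exact_mod_cast hn.ne'
  have hy : y = x * m / n := by field_simp at hq ⊢; linarith
  have h1 : ((2 * (n / x)) ^ 3 : ℚ) = (2 * (m * n * (m + n)) : ℤ) := by
    rw [hy] at h
    push_cast
    field_simp at h ⊢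
    linear_combination -h
  obtain ⟨w, hw⟩ : ∃ w : ℤ, (w : ℚ) = 2 * (n / x) := by
    have : IsIntegral ℤ (2 * (n / x) : ℚ) := by
      refine IsIntegral.of_pow three_pos ?_
      rw [h1]
      exact isIntegral_algebraMap
    exact IsIntegrallyClosed.isIntegral_iff.1 this
  rw [← hw] at h1
  have h2 : w ^ 3 = 2 * (m * n * (m + n)) := by exact_mod_cast h1
  obtain ⟨v, rfl⟩ : 2 ∣ w := Int.prime_two.dvd_of_dvd_pow ⟨_, h2⟩
  have hv := Int.eq_zero_of_mul_mul_add_eq_four_mul_cube hmn (v := v) (by linarith)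
  rw [hv] at hw
  simp at hw
  rcases hw with hw | hw
  · omega
  · exact hx hw

section QuadraticField

variable {K : Type*} [Field K] [NumberField K]

theorem eq_zero_and_eq_zero_of_irrational {x : K} (hx : ∀ q : ℚ, x ≠ q) {a b : ℚ}
    (h : (a : K) * x + b = 0) : a = 0 ∧ b = 0 := by
  have ha : a = 0 := by
    by_contra ha
    have ha' : (a : K) ≠ 0 := by exact_mod_cast ha
    refine hx (-b / a) ?_
    push_cast
    field_simp
    linear_combination h
  subst ha
  simpa using h

theorem exists_eq_rat_mul_add (hdeg : Module.finrank ℚ K = 2) {x : K} (hx : ∀ q : ℚ, x ≠ q)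
    (y : K) : ∃ α β : ℚ, y = α * x + β := by
  have hli : LinearIndependent ℚ ![x, 1] := by
    refine LinearIndependent.pair_iff.2 fun s t h => ?_
    refine eq_zero_and_eq_zero_of_irrational hx ?_
    simpa [Rat.smul_def] using h
  have htop := hli.span_eq_top_of_card_eq_finrank (by simp [hdeg])
  have hy : y ∈ Submodule.span ℚ (Set.range ![x, 1]) := by rw [htop]; trivial
  simp only [Matrix.range_cons, Matrix.range_empty, Set.union_empty, Set.singleton_union] at hy
  obtain ⟨α, β, h⟩ := Submodule.mem_span_pair.1 hy
  exact ⟨α, β, by rw [← h]; simp [Rat.smul_def]⟩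

/-- An irrational element of a quadratic field is moved by an involution all of whose traces and
norms are rational. -/
theorem exists_conjugation (hdeg : Module.finrank ℚ K = 2) {x : K} (hx : ∀ q : ℚ, x ≠ q) :
    ∃ σ : K →+* K, σ x ≠ x ∧ ∀ t, (∃ P : ℚ, t + σ t = P) ∧ ∃ Q : ℚ, t * σ t = Q := by
  have : Algebra.IsQuadraticExtension ℚ K := ⟨hdeg⟩
  obtain ⟨σ, hσ⟩ : ∃ σ : K ≃ₐ[ℚ] K, σ x ≠ x := by
    by_contra! h
    obtain ⟨q, hq⟩ := (IsGalois.mem_bot_iff_fixed (F := ℚ) (E := K) x).2 h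
    exact hx q (by rw [← hq]; simp)
  obtain ⟨S, N, hSN⟩ := exists_eq_rat_mul_add hdeg hx (x ^ 2)
  have hσx : σ x = S - x := by
    have h1 : (σ x) ^ 2 = S * σ x + N := by
      have := congrArg σ hSN
      simpa using this
    have h2 : (σ x - x) * (σ x - (S - x)) = 0 := by linear_combination h1 - hSN
    rcases mul_eq_zero.1 h2 with h3 | h3
    · exact (hσ (sub_eq_zero.1 h3)).elim
    · exact sub_eq_zero.1 h3
  refine ⟨(σ : K →+* K), hσ, fun t => ?_⟩
  obtain ⟨α, β, rfl⟩ := exists_eq_rat_mul_add hdeg hx t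
  have h1 : ((σ : K →+* K) (α * x + β) : K) = α * (S - x) + β := by simp [hσx]
  rw [h1]
  refine ⟨⟨α * S + 2 * β, by push_cast; ring⟩, ⟨-α ^ 2 * N + α * β * S + β ^ 2, ?_⟩⟩
  push_cast
  linear_combination -α ^ 2 * hSN

theorem exists_rat_root_of_cubic (hdeg : Module.finrank ℚ K = 2) {a b c d : ℚ} (ha : a ≠ 0) {x : K}
    (h : a * x ^ 3 + b * x ^ 2 + c * x + d = 0) :
    ∃ q : ℚ, a * q ^ 3 + b * q ^ 2 + c * q + d = 0 := by
  by_cases hx : ∀ q : ℚ, x ≠ q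
  · obtain ⟨S, N, hSN⟩ := exists_eq_rat_mul_add hdeg hx (x ^ 2)
    obtain ⟨h1, h2⟩ := eq_zero_and_eq_zero_of_irrational hx
      (a := a * (S ^ 2 + N) + b * S + c) (b := a * S * N + b * N + d) (by
        push_cast
        linear_combination h - (a * x + a * S + b) * hSN)
    refine ⟨-(b / a + S), ?_⟩
    obtain rfl : c = -(a * (S ^ 2 + N) + b * S) := by linarith
    obtain rfl : d = -(a * S * N + b * N) := by linarith
    field_simp
    ring
  · push Not at hx
    obtain ⟨q, rfl⟩ := hx
    exact ⟨q, by exact_mod_cast h⟩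

/-- A binary cubic form over `ℚ` without rational zeros has only the trivial zero. -/
theorem eq_zero_and_eq_zero_of_cubic_form (hdeg : Module.finrank ℚ K = 2) {b c d : ℚ}
    (hroot : ∀ q : ℚ, q ^ 3 + b * q ^ 2 + c * q + d ≠ 0) {x y : K}
    (h : x ^ 3 + b * x ^ 2 * y + c * x * y ^ 2 + d * y ^ 3 = 0) : x = 0 ∧ y = 0 := by
  have hy : y = 0 := by
    by_contra hy
    obtain ⟨q, hq⟩ := exists_rat_root_of_cubic hdeg (a := 1) (b := b) (c := c) (d := d) one_ne_zero
      (x := x / y) (by push_cast; field_simp; linear_combination h)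
    exact hroot q (by linarith)
  subst hy
  simpa using h

end QuadraticField

theorem not_exists_sq_sum_eq_four {K : Type*} [Field K] [NumberField K]
    (hdeg : Module.finrank ℚ K = 2) {q : ℚ} {r s e : K} (hr : ∀ a : ℚ, r ≠ a) (hsum : r + s = -q)
    (hmul : r * s * q = -4) : r ^ 2 + 4 ≠ e ^ 2 := by
  intro he
  have hq : q ≠ 0 := by rintro rfl; norm_num at hmul
  have hq' : (q : K) ≠ 0 := by exact_mod_cast hq
  have hr2 : r ^ 2 = -q * r + 4 / q := by
    field_simp
    linear_combination r * q * hsum - hmul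
  obtain ⟨α, β, rfl⟩ := exists_eq_rat_mul_add hdeg hr e
  obtain ⟨h1, h2⟩ := eq_zero_and_eq_zero_of_irrational hr
    (a := -q * α ^ 2 + 2 * α * β + q) (b := 4 / q * α ^ 2 + β ^ 2 - 4 / q - 4) (by
      push_cast
      linear_combination -he + (1 - α ^ 2) * hr2)
  have h3 : q ^ 4 + 4 * (q + 1) ^ 2 = (q * (β ^ 2 - α * β * q - 4 / q * α ^ 2) / 2) ^ 2 := by
    have h4 : (β ^ 2 - α * β * q - 4 / q * α ^ 2) ^ 2 =
        (4 / q * α ^ 2 + β ^ 2) ^ 2 - (4 / q * α ^ 2 + β ^ 2) * (-q * α ^ 2 + 2 * α * β) * q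
        - 4 / q * (-q * α ^ 2 + 2 * α * β) ^ 2 := by
      field_simp
      ring
    rw [show -q * α ^ 2 + 2 * α * β = -q by linarith,
      show 4 / q * α ^ 2 + β ^ 2 = 4 / q + 4 by linarith] at h4
    rw [div_pow, mul_pow, h4]
    field_simp
    ring
  rcases Rat.eq_zero_or_eq_neg_one_of_sq_eq h3 with h0 | rfl
  · exact hq h0
  have h5 : (β - 2 * α) * (β + 2 * α) = 0 := by linarith
  rcases mul_eq_zero.1 h5 with h6 | h6
  · obtain rfl : β = 2 * α := by linarith
    obtain ⟨w, hw, hw2⟩ := Rat.exists_int_of_sq_eq_intCast (r := 5 * α) (z := 5)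
      (by push_cast; linarith)
    have : w < 3 := by nlinarith
    have : -3 < w := by nlinarith
    interval_cases w <;> omega
  · obtain rfl : β = -2 * α := by linarith
    nlinarith [sq_nonneg α]

theorem false_of_mul_mul_add_eq_four {K : Type*} [Field K] [NumberField K]
    (hdeg : Module.finrank ℚ K = 2) {r s d e : K} (h : r * s * (r + s) = 4) (hr : r ^ 2 + 4 = d ^ 2)
    (hs : s ^ 2 + 4 = e ^ 2) : False := by
  by_cases hr' : ∀ q : ℚ, r ≠ q
  · obtain ⟨α, β, hαβ⟩ := exists_eq_rat_mul_add hdeg hr' s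
    by_cases hα : α * (1 + α) = 0
    · rcases mul_eq_zero.1 hα with rfl | hα
      · have hsβ : s = β := by rw [hαβ]; simp
        exact not_exists_sq_sum_eq_four hdeg (q := β) (s := -(r + s)) hr' (by rw [hsβ]; ring)
          (by rw [← hsβ]; linear_combination -h) hr
      · obtain rfl : α = -1 := by linarith
        have hsβ : r + s = β := by rw [hαβ]; push_cast; ring
        exact not_exists_sq_sum_eq_four hdeg (q := -β) (s := s) hr' (by rw [hsβ]; push_cast; ring)
          (by push_cast; rw [← hsβ]; linear_combination -h) hr
    · obtain ⟨q, hq⟩ := exists_rat_root_of_cubic hdeg (a := α * (1 + α)) (b := β * (1 + 2 * α))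
        (c := β ^ 2) (d := -4) hα (x := r) (by
          push_cast
          rw [hαβ] at h
          linear_combination h)
      exact Rat.mul_mul_add_ne_four q (α * q + β) (by linear_combination hq)
  · push Not at hr'
    obtain ⟨q, rfl⟩ := hr'
    by_cases hs' : ∀ a : ℚ, s ≠ a
    · exact not_exists_sq_sum_eq_four hdeg (q := q) (s := -(q + s)) hs' (by ring)
        (by linear_combination -h) hs
    · push Not at hs'
      obtain ⟨q', rfl⟩ := hs'
      exact Rat.mul_mul_add_ne_four q q' (by exact_mod_cast h)

section FourCycle

variable {K : Type*} [Field K] {c x₀ x₁ x₂ x₃ : K}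

theorem four_cycle_mul_eq_neg_one (h₁ : x₁ = x₀ ^ 2 + c) (h₂ : x₂ = x₁ ^ 2 + c)
    (h₃ : x₃ = x₂ ^ 2 + c) (h₀ : x₀ = x₃ ^ 2 + c) (hne : x₂ ≠ x₀) :
    (x₀ + x₂) * (x₁ + x₃) = -1 := by
  have h : ((x₀ + x₂) * (x₁ + x₃) + 1) * (x₂ - x₀) = 0 := by
    linear_combination (x₁ + x₃) * (h₁ - h₃) + h₂ - h₀
  rcases mul_eq_zero.1 h with h | h
  · linear_combination h
  · exact (hne (sub_eq_zero.1 h)).elim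

theorem four_cycle_cubic [CharZero K] (h₁ : x₁ = x₀ ^ 2 + c) (h₂ : x₂ = x₁ ^ 2 + c)
    (h₃ : x₃ = x₂ ^ 2 + c) (h₀ : x₀ = x₃ ^ 2 + c) (hne : x₂ ≠ x₀) :
    (x₀ + x₁ + x₂ + x₃) ^ 3 + (4 * c + 3) * (x₀ + x₁ + x₂ + x₃) + 4 = 0 := by
  have hAB := four_cycle_mul_eq_neg_one h₁ h₂ h₃ h₀ hne
  obtain ⟨A, hA⟩ : ∃ A, A = x₀ + x₂ := ⟨_, rfl⟩
  obtain ⟨B, hB⟩ : ∃ B, B = x₁ + x₃ := ⟨_, rfl⟩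
  rw [← hA, ← hB] at hAB
  have hP : 2 * (x₀ * x₂) = A ^ 2 - B + 2 * c := by
    rw [hA, hB]; linear_combination h₁ + h₃
  have hR : 2 * (x₁ * x₃) = B ^ 2 - A + 2 * c := by
    rw [hA, hB]; linear_combination h₂ + h₀
  have hRP : x₁ * x₃ = (x₀ * x₂) ^ 2 + c * (B - 2 * c) + c ^ 2 := by
    rw [hB]; linear_combination x₃ * h₁ + (x₀ ^ 2 + c) * h₃ - c * (h₁ + h₃)
  have key : 4 * c * (A ^ 2 - 1) = B ^ 2 - 4 * A - A ^ 4 := by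
    linear_combination -4 * hRP + 2 * hR - (2 * (x₀ * x₂) + A ^ 2 - B + 2 * c) * hP + 2 * A * hAB
  rw [show x₀ + x₁ + x₂ + x₃ = A + B by rw [hA, hB]; ring]
  linear_combination -B * key + (4 * c * A + 4 + A ^ 3 + 3 * (A + B)) * hAB

theorem mem_four_cycle_of_sum_eq [CharZero K] {y₀ y₁ y₂ y₃ : K} (h₁ : x₁ = x₀ ^ 2 + c)
    (h₂ : x₂ = x₁ ^ 2 + c) (h₃ : x₃ = x₂ ^ 2 + c) (h₀ : x₀ = x₃ ^ 2 + c) (hne : x₂ ≠ x₀)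
    (k₁ : y₁ = y₀ ^ 2 + c) (k₂ : y₂ = y₁ ^ 2 + c)
    (k₃ : y₃ = y₂ ^ 2 + c) (k₀ : y₀ = y₃ ^ 2 + c) (kne : y₂ ≠ y₀)
    (hsum : y₀ + y₁ + y₂ + y₃ = x₀ + x₁ + x₂ + x₃) : y₀ = x₀ ∨ y₀ = x₁ ∨ y₀ = x₂ ∨ y₀ = x₃ := by
  have hx := four_cycle_mul_eq_neg_one h₁ h₂ h₃ h₀ hne
  have hy := four_cycle_mul_eq_neg_one k₁ k₂ k₃ k₀ kne
  have h : (y₀ + y₂ - (x₀ + x₂)) * (y₀ + y₂ - (x₁ + x₃)) = 0 := by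
    linear_combination (y₀ + y₂) * hsum - hy + hx
  rcases mul_eq_zero.1 h with h | h
  · have h' : (2 * y₀ - 2 * x₀) * (2 * y₀ - 2 * x₂) = 0 := by
      linear_combination (3 * y₀ - y₂ - x₀ - x₂) * h - 2 * (k₁ + k₃ - h₁ - h₃) + 2 * (hsum - h)
        - (y₀ + y₂ + x₀ + x₂) * h
    rcases mul_eq_zero.1 h' with h' | h'
    · exact Or.inl (mul_left_cancel₀ two_ne_zero (sub_eq_zero.1 h'))
    · exact Or.inr (Or.inr (Or.inl (mul_left_cancel₀ two_ne_zero (sub_eq_zero.1 h'))))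
  · have h' : (2 * y₀ - 2 * x₁) * (2 * y₀ - 2 * x₃) = 0 := by
      linear_combination (3 * y₀ - y₂ - x₁ - x₃) * h - 2 * (k₁ + k₃ - h₂ - h₀) + 2 * (hsum - h)
        - (y₀ + y₂ + x₁ + x₃) * h
    rcases mul_eq_zero.1 h' with h' | h'
    · exact Or.inr (Or.inl (mul_left_cancel₀ two_ne_zero (sub_eq_zero.1 h')))
    · exact Or.inr (Or.inr (Or.inr (mul_left_cancel₀ two_ne_zero (sub_eq_zero.1 h'))))

theorem mem_four_cycle [NumberField K] (hdeg : Module.finrank ℚ K = 2) {y₀ y₁ y₂ y₃ : K}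
    (h₁ : x₁ = x₀ ^ 2 + c)
    (h₂ : x₂ = x₁ ^ 2 + c) (h₃ : x₃ = x₂ ^ 2 + c) (h₀ : x₀ = x₃ ^ 2 + c) (hne : x₂ ≠ x₀)
    (k₁ : y₁ = y₀ ^ 2 + c) (k₂ : y₂ = y₁ ^ 2 + c)
    (k₃ : y₃ = y₂ ^ 2 + c) (k₀ : y₀ = y₃ ^ 2 + c) (kne : y₂ ≠ y₀) :
    y₀ = x₀ ∨ y₀ = x₁ ∨ y₀ = x₂ ∨ y₀ = x₃ := by
  refine mem_four_cycle_of_sum_eq h₁ h₂ h₃ h₀ hne k₁ k₂ k₃ k₀ kne ?_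
  by_contra hsum
  have hx := four_cycle_mul_eq_neg_one h₁ h₂ h₃ h₀ hne
  have hy := four_cycle_mul_eq_neg_one k₁ k₂ k₃ k₀ kne
  have hx3 := four_cycle_cubic h₁ h₂ h₃ h₀ hne
  have hy3 := four_cycle_cubic k₁ k₂ k₃ k₀ kne
  obtain ⟨r, hr⟩ : ∃ r, r = y₀ + y₁ + y₂ + y₃ := ⟨_, rfl⟩
  obtain ⟨s, hs⟩ : ∃ s, s = x₀ + x₁ + x₂ + x₃ := ⟨_, rfl⟩
  rw [← hr, ← hs] at hsum
  rw [← hr] at hy3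
  rw [← hs] at hx3
  have h := mul_left_cancel₀ (a := r - s) (b := r * s * (r + s)) (c := 4) (sub_ne_zero.2 hsum)
    (by linear_combination s * hy3 - r * hx3)
  refine false_of_mul_mul_add_eq_four hdeg h (d := y₀ + y₂ - (y₁ + y₃))
    (e := x₀ + x₂ - (x₁ + x₃)) ?_ ?_
  · rw [hr]; linear_combination 4 * hy
  · rw [hs]; linear_combination 4 * hx

end FourCycle

/-- An integral cubic without roots modulo `2` has no rational root. -/
theorem Rat.cubic_ne_zero_of_odd {b c d : ℤ} (hd : d % 2 = 1) (hbc : (b + c) % 2 = 1) (q : ℚ) :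
    q ^ 3 + b * q ^ 2 + c * q + d ≠ 0 := by
  intro h
  obtain ⟨m, n, hn, hmn, rfl⟩ := Rat.exists_eq_div_isCoprime q
  have hn0 : (n : ℚ) ≠ 0 := by exact_mod_cast hn.ne'
  have h1 : m ^ 3 + b * m ^ 2 * n + c * m * n ^ 2 + d * n ^ 3 = 0 := by
    field_simp at h
    have : (m ^ 3 + b * m ^ 2 * n + c * m * n ^ 2 + d * n ^ 3 : ℚ) = 0 := by linear_combination h
    exact_mod_cast this
  have h2 : (m ^ 3 + b * m ^ 2 * n + c * m * n ^ 2 + d * n ^ 3) % 2 = 0 := by rw [h1]; rfl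
  rcases Int.emod_two_eq_zero_or_one m with hm | hm <;>
    rcases Int.emod_two_eq_zero_or_one n with hn' | hn'
  · exact Int.prime_two.not_isUnit (hmn.isUnit_of_dvd' (Int.dvd_of_emod_eq_zero hm)
      (Int.dvd_of_emod_eq_zero hn'))
  all_goals
    simp [pow_succ, Int.add_emod, Int.mul_emod, hm, hn', hd] at h2
  omega

/-- An integral quartic without roots modulo `3` has no rational root. -/
theorem Rat.quartic_ne_zero_of_zmod_three {a b c d : ℤ}
    (hroot : ∀ x : ZMod 3, x ^ 4 + a * x ^ 3 + b * x ^ 2 + c * x + d ≠ 0) (q : ℚ) :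
    q ^ 4 + a * q ^ 3 + b * q ^ 2 + c * q + d ≠ 0 := by
  intro h
  obtain ⟨m, n, hn, hmn, rfl⟩ := Rat.exists_eq_div_isCoprime q
  have hn0 : (n : ℚ) ≠ 0 := by exact_mod_cast hn.ne'
  have h1 : m ^ 4 + a * m ^ 3 * n + b * m ^ 2 * n ^ 2 + c * m * n ^ 3 + d * n ^ 4 = 0 := by
    field_simp at h
    have : (m ^ 4 + a * m ^ 3 * n + b * m ^ 2 * n ^ 2 + c * m * n ^ 3 + d * n ^ 4 : ℚ) = 0 := by
      linear_combination h
    exact_mod_cast this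
  have h2 := congrArg (Int.cast : ℤ → ZMod 3) h1
  push_cast at h2
  have hp : Fact (Nat.Prime 3) := ⟨Nat.prime_three⟩
  by_cases h3 : (n : ZMod 3) = 0
  · have h4 : (m : ZMod 3) = 0 := by
      rw [h3] at h2
      exact pow_eq_zero_iff four_ne_zero |>.1 (by linear_combination h2)
    rw [ZMod.intCast_zmod_eq_zero_iff_dvd] at h3 h4
    exact Int.prime_three.not_isUnit (hmn.isUnit_of_dvd' h4 h3)
  · refine hroot (m / n) ?_
    field_simp
    linear_combination h2

theorem Rat.sq_ne_thirtyTwo (q : ℚ) : q ^ 2 ≠ 32 := by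
  intro h
  obtain ⟨w, -, hw⟩ := Rat.exists_int_of_sq_eq_intCast (r := q) (z := 32) (by exact_mod_cast h)
  have : w < 6 := by nlinarith
  have : -6 < w := by nlinarith
  interval_cases w <;> omega

theorem Rat.sq_ne_two (q : ℚ) : q ^ 2 ≠ 2 := by
  intro h
  exact Rat.sq_ne_thirtyTwo (4 * q) (by linarith)

section

variable {K : Type*} [Field K] [NumberField K]

theorem exists_of_sq_eq_elliptic (hdeg : Module.finrank ℚ K = 2) {x y : K} (hx : ∀ q : ℚ, x ≠ q)
    {P₁ P₀ : ℚ} (hP : x ^ 2 = P₁ * x - P₀) (hy : y ≠ 0)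
    (h : y ^ 2 = (x + 7) * (x ^ 2 + 3 * x + 4)) :
    ∃ α : ℚ, (α ≠ 0 ∧ P₁ = α ^ 2 - 3 ∧ P₀ = 4 - 7 * α ^ 2) ∨
      (P₁ = α ^ 2 - 11 ∧ P₀ = α ^ 2 - 16 * α + 36) ∨
      (P₁ = α ^ 2 - 7 ∧ P₀ = 4 - 8 * α - 3 * α ^ 2) := by
  obtain ⟨α, β, rfl⟩ := exists_eq_rat_mul_add hdeg hx y
  obtain ⟨h1, h2⟩ := eq_zero_and_eq_zero_of_irrational hx
    (a := P₁ ^ 2 - P₀ + 10 * P₁ + 25 - α ^ 2 * P₁ - 2 * α * β)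
    (b := -P₀ * P₁ - 10 * P₀ + 28 - β ^ 2 + α ^ 2 * P₀) (by
      push_cast
      linear_combination -h - (x + P₁ + 10 - α ^ 2) * hP)
  obtain ⟨ρ, hρ⟩ : ∃ ρ, ρ = α ^ 2 - 10 - P₁ := ⟨_, rfl⟩
  obtain rfl : P₁ = α ^ 2 - 10 - ρ := by linarith
  rcases Rat.eq_of_elliptic_eleven (x := ρ) (y := α * ρ + β) (by
    linear_combination ρ * h1 + h2) with rfl | rfl | rfl
  · have hβ : β = 7 * α := by
      have : (β - 7 * α) ^ 2 = 0 := by linear_combination 7 * h1 - h2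
      linarith [pow_eq_zero_iff two_ne_zero |>.1 this]
    subst hβ
    refine ⟨α, Or.inl ⟨?_, by ring, by linear_combination -h2 / 7⟩⟩
    rintro rfl
    simp at hy
  · have hβ : (β + α - 8) * (β + α + 8) = 0 := by linear_combination -h1 - h2
    rcases mul_eq_zero.1 hβ with hβ | hβ
    · obtain rfl : β = 8 - α := by linarith
      exact ⟨α, Or.inr (Or.inl ⟨by ring, by linear_combination h2⟩)⟩
    · obtain rfl : β = -8 - α := by linarith
      exact ⟨-α, Or.inr (Or.inl ⟨by ring, by linear_combination h2⟩)⟩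
  · have hβ : (β - 3 * α - 4) * (β - 3 * α + 4) = 0 := by linear_combination 3 * h1 - h2
    rcases mul_eq_zero.1 hβ with hβ | hβ
    · obtain rfl : β = 3 * α + 4 := by linarith
      exact ⟨α, Or.inr (Or.inr ⟨by ring, by linear_combination -h2 / 3⟩)⟩
    · obtain rfl : β = 3 * α - 4 := by linarith
      exact ⟨-α, Or.inr (Or.inr ⟨by ring, by linear_combination -h2 / 3⟩)⟩

theorem eq_of_sq_eq_elliptic_twist (hdeg : Module.finrank ℚ K = 2) {z w : K}
    (hz : ∀ q : ℚ, z ≠ q) {p n : ℚ} (hP : z ^ 2 = p * z - n)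
    (h : w ^ 2 = (1 + 7 * z) * (1 + 3 * z + 4 * z ^ 2)) :
    p = 7 * n ^ 2 - 5 * n ∨ 16 * (53 + 28 * p) = (29 + 7 * (p - n)) ^ 2 ∨ p = 1 - 7 * n := by
  obtain ⟨α, β, rfl⟩ := exists_eq_rat_mul_add hdeg hz w
  obtain ⟨h1, h2⟩ := eq_zero_and_eq_zero_of_irrational hz
    (a := 28 * (p ^ 2 - n) + 25 * p + 10 - α ^ 2 * p - 2 * α * β)
    (b := -28 * p * n - 25 * n + 1 - β ^ 2 + α ^ 2 * n) (by
      push_cast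
      linear_combination -h - (28 * z + 28 * p + 25 - α ^ 2) * hP)
  obtain ⟨ρ, hρ⟩ : ∃ ρ, ρ = (α ^ 2 - 25) / 28 - p := ⟨_, rfl⟩
  obtain rfl : p = (α ^ 2 - 25) / 28 - ρ := by linarith
  rcases Rat.eq_of_elliptic_thirteen (z := ρ) (w := α * ρ + β) (by
    linear_combination ρ * h1 + h2) with rfl | rfl | rfl
  · have hβ : β = α / 7 := by
      have : (β - α / 7) ^ 2 = 0 := by linear_combination 1 / 7 * h1 - h2
      linarith [pow_eq_zero_iff two_ne_zero |>.1 this]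
    subst hβ
    right; right
    linear_combination -7 / 4 * h2
  · left
    have hβ : β ^ 2 = 1 := by linear_combination -h2
    have h3 : 2 * α * β = 10 - 28 * n := by linear_combination -h1
    have h4 : 4 * α ^ 2 = (10 - 28 * n) ^ 2 := by
      rw [← h3]; linear_combination -4 * α ^ 2 * hβ
    linear_combination h4 / 112
  · right; left
    have hβ : (α + β) ^ 2 = 64 := by linear_combination -h1 - h2
    have h3 : β ^ 2 = 1 + 28 * n := by linear_combination -h2
    have h4 : 2 * α * (α + β) = 63 - 28 * n + α ^ 2 := by linear_combination hβ - h3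
    have h5 : 4 * α ^ 2 * 64 = (63 - 28 * n + α ^ 2) ^ 2 := by
      rw [← h4, ← hβ]; ring
    linear_combination h5 / 16

end

theorem Rat.trace_norm_cases {S N P₁ P₀ : ℚ} (hP₁ : P₁ = S ^ 2 - 2 * N) (hP₀ : P₀ = N ^ 2)
    (hS : S ≠ 0) (hSN : ¬ (N = 1 ∧ S ^ 2 = 4))
    (h₁ : ∃ α : ℚ, (α ≠ 0 ∧ P₁ = α ^ 2 - 3 ∧ P₀ = 4 - 7 * α ^ 2) ∨
      (P₁ = α ^ 2 - 11 ∧ P₀ = α ^ 2 - 16 * α + 36) ∨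
      (P₁ = α ^ 2 - 7 ∧ P₀ = 4 - 8 * α - 3 * α ^ 2))
    (h₂ : P₀ * (P₁ + 5) = 7 ∨ P₀ ^ 2 + 6 * P₀ * P₁ + 58 * P₀ - 7 * (P₁ - 1) ^ 2 = 0 ∨
      P₁ = P₀ - 7) :
    (N = 3 / 2 ∧ S ^ 2 = 1 / 4) ∨ (N = 6 ∧ S ^ 2 = 1) ∨ (N = 3 ∧ S ^ 2 = 16 / 9) := by
  have hS2 : 0 < S ^ 2 := by positivity
  -- a positive square `S²` forces the sign of `N`
  have hN : ∀ k : ℚ, P₀ = k ^ 2 → P₁ - 2 * k ≤ 0 → N = k ∧ S ^ 2 = P₁ + 2 * k := by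
    intro k hk hle
    have h : (N - k) * (N + k) = 0 := by linear_combination hk - hP₀
    rcases mul_eq_zero.1 h with h | h
    · obtain rfl : N = k := by linarith
      exact ⟨rfl, by linarith⟩
    · obtain rfl : N = -k := by linarith
      linarith
  obtain ⟨α, ⟨hα, rfl, rfl⟩ | ⟨rfl, rfl⟩ | ⟨rfl, rfl⟩⟩ := h₁
  · rcases h₂ with h | h | h
    · exact (Rat.sq_ne_thirtyTwo (7 * α ^ 2 + 5) (by linear_combination -7 * h)).elim
    · have hk : α ^ 2 = 1 / 4 := by linear_combination -h / 256
      obtain ⟨rfl, h⟩ := hN (3 / 2) (by linarith) (by linarith)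
      exact Or.inl ⟨rfl, by linarith⟩
    · exact (hα (pow_eq_zero_iff two_ne_zero |>.1 (by linarith))).elim
  · rcases h₂ with h | h | h
    · refine (Rat.quartic_ne_zero_of_zmod_three (a := -16) (b := 30) (c := 96) (d := -223)
        (by decide) α ?_).elim
      push_cast
      linear_combination h
    · have h3 : α * (2 * α ^ 2 - 11 * α + 16) = 0 := by linear_combination -h / 64
      rcases mul_eq_zero.1 h3 with rfl | h3
      · obtain ⟨rfl, h⟩ := hN 6 (by norm_num) (by norm_num)
        exact Or.inr (Or.inl ⟨rfl, by linarith⟩)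
      · nlinarith [sq_nonneg (4 * α - 11)]
    · obtain rfl : α = 5 / 2 := by linarith
      obtain ⟨-, h⟩ := hN (3 / 2) (by norm_num) (by norm_num)
      norm_num at h
      linarith
  · rcases h₂ with h | h | h
    · have h3 : (α - 1) ^ 2 * (α + 3) * (3 * α + 5) = 0 := by linear_combination -h
      rcases mul_eq_zero.1 h3 with h3 | h3
      · rcases mul_eq_zero.1 h3 with h3 | h3
        · obtain rfl : α = 1 := by linarith [pow_eq_zero_iff two_ne_zero |>.1 h3]
          nlinarith [sq_nonneg N]
        · obtain rfl : α = -3 := by linarith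
          exact (hSN ((hN 1 (by norm_num) (by norm_num)).imp_right fun h => by linarith)).elim
      · obtain rfl : α = -5 / 3 := by linarith
        obtain ⟨rfl, h⟩ := hN 3 (by norm_num) (by norm_num)
        exact Or.inr (Or.inr ⟨rfl, by linarith⟩)
    · refine (Rat.quartic_ne_zero_of_zmod_three (a := 0) (b := -8) (c := 12) (d := 23)
        (by decide) α ?_).elim
      push_cast
      linear_combination -h / 16
    · exact (Rat.sq_ne_two (α + 1) (by linear_combination h / 4)).elim

/-- Points of `y² = (r² + 7) (r⁴ + 3 r² + 4)` over a quadratic field with irrational `r`. -/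
theorem exists_of_sq_eq_sextic {K : Type*} [Field K] [NumberField K]
    (hdeg : Module.finrank ℚ K = 2) {r y : K} (hr : ∀ q : ℚ, r ≠ q) (hr3 : r ^ 2 ≠ -3) (hy : y ≠ 0)
    (h : y ^ 2 = (r ^ 2 + 7) * (r ^ 4 + 3 * r ^ 2 + 4)) :
    ∃ s : K, s ^ 2 = 1 ∧
      (2 * r ^ 2 + s * r + 3) * (r ^ 2 + s * r + 6) * (3 * r ^ 2 - 4 * s * r + 9) = 0 := by
  obtain ⟨S, N', hSN'⟩ := exists_eq_rat_mul_add hdeg hr (r ^ 2)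
  obtain ⟨N, rfl⟩ : ∃ N, N' = -N := ⟨-N', by ring⟩
  have hSN : r ^ 2 = S * r - N := by rw [hSN']; push_cast; ring
  clear hSN'
  have hr0 : r ≠ 0 := by simpa using hr 0
  have hr1 : r ^ 2 ≠ 1 := by
    intro h1
    rcases mul_self_eq_one_iff.1 ((sq r).symm.trans h1) with h1 | h1
    · exact hr 1 (by simpa using h1)
    · exact hr (-1) (by simpa using h1)
  by_cases hS : S = 0
  · exfalso
    subst hS
    have hD : r ^ 2 = -N := by simpa using hSN
    obtain ⟨u, v, rfl⟩ := exists_eq_rat_mul_add hdeg hr y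
    obtain ⟨h1, h2⟩ := eq_zero_and_eq_zero_of_irrational hr (a := 2 * u * v)
      (b := -N * u ^ 2 + v ^ 2 - (-N + 7) * (N ^ 2 - 3 * N + 4)) (by
        rw [show r ^ 4 = (r ^ 2) ^ 2 by ring, hD] at h
        push_cast
        linear_combination h - u ^ 2 * hD)
    have hN7 : N ≠ 7 := by
      rintro rfl
      rw [hD] at h
      refine hy (pow_eq_zero_iff two_ne_zero |>.1 ?_)
      rw [h]; push_cast; ring
    have hN1 : N ≠ -1 := by
      rintro rfl
      exact hr1 (by rw [hD]; norm_num)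
    have hN3 : N ≠ 3 := by
      rintro rfl
      exact hr3 (by rw [hD]; norm_num)
    have hN0 : N ≠ 0 := by
      rintro rfl
      exact hr0 (pow_eq_zero_iff two_ne_zero |>.1 (by rw [hD]; norm_num))
    rcases mul_eq_zero.1 h1 with h1 | rfl
    · obtain rfl : u = 0 := by linarith
      rcases Rat.eq_of_elliptic_eleven (x := -N) (y := v) (by linear_combination -h2)
        with h3 | h3 | h3
      · exact hN7 (by linarith)
      · exact hN1 (by linarith)
      · exact hN3 (by linarith)
    · rcases Rat.eq_of_elliptic_thirteen (z := -1 / N) (w := u / N) (by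
        field_simp
        linear_combination h2) with h3 | h3 | h3 <;> field_simp at h3
      · exact hN7 (by linarith)
      · norm_num at h3
      · exact hN1 (by linarith)
  have hS' : (S : K) ≠ 0 := by exact_mod_cast hS
  have hN : N ≠ 0 := by
    rintro rfl
    exact hr S (mul_left_cancel₀ hr0 (by linear_combination hSN))
  have hx : ∀ q : ℚ, r ^ 2 ≠ q := by
    intro q hq
    refine hr ((q + N) / S) ?_
    push_cast
    field_simp
    linear_combination hq - hSN
  have hz : ∀ q : ℚ, 1 / r ^ 2 ≠ q := by
    intro q hq
    refine hx (1 / q) ?_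
    push_cast
    rw [← hq, one_div_one_div]
  have hx2 : (r ^ 2) ^ 2 = (S ^ 2 - 2 * N : ℚ) * r ^ 2 - (N ^ 2 : ℚ) := by
    push_cast
    linear_combination (r ^ 2 + S * r + N) * hSN
  have hN' : (N : K) ≠ 0 := by exact_mod_cast hN
  have h1 := exists_of_sq_eq_elliptic hdeg hx hx2 hy (by rw [h]; ring)
  have h2 := eq_of_sq_eq_elliptic_twist hdeg hz (p := (S ^ 2 - 2 * N) / N ^ 2) (n := 1 / N ^ 2)
    (w := y / r ^ 3) (by
      push_cast at hx2 ⊢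
      field_simp
      linear_combination hx2) (by
      field_simp
      linear_combination h)
  have h3 := Rat.trace_norm_cases (S := S) (N := N) rfl rfl hS (by
    rintro ⟨rfl, hS4⟩
    have hS4 : (S : K) ^ 2 = 4 := by exact_mod_cast hS4
    push_cast at hSN
    have : (r ^ 2 - 1) ^ 2 = 0 := by
      linear_combination (r ^ 2 + 1 + S * r) * hSN + r ^ 2 * hS4
    exact hr1 (sub_eq_zero.1 (pow_eq_zero_iff two_ne_zero |>.1 this))) h1 (by
    refine h2.imp (fun h2 => ?_) (Or.imp (fun h2 => ?_) fun h2 => ?_)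
    · field_simp at h2
      linear_combination h2
    · field_simp at h2
      linear_combination h2 / 7
    · field_simp at h2
      linear_combination h2)
  have hsq : ∀ k : ℚ, k ≠ 0 → S ^ 2 = k ^ 2 → ∃ s : ℚ, s ^ 2 = 1 ∧ S = s * k := by
    intro k hk hSk
    exact ⟨S / k, by rw [div_pow, hSk]; field_simp, by field_simp⟩
  rcases h3 with ⟨rfl, h3⟩ | ⟨rfl, h3⟩ | ⟨rfl, h3⟩
  · obtain ⟨s, hs, rfl⟩ := hsq (-1 / 2) (by norm_num) (by linarith)
    refine ⟨s, by exact_mod_cast hs, ?_⟩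
    rw [show 2 * r ^ 2 + s * r + 3 = 0 by rw [hSN]; push_cast; ring]
    ring
  · obtain ⟨s, hs, rfl⟩ := hsq (-1) (by norm_num) (by linarith)
    refine ⟨s, by exact_mod_cast hs, ?_⟩
    rw [show r ^ 2 + s * r + 6 = 0 by rw [hSN]; push_cast; ring]
    ring
  · obtain ⟨s, hs, rfl⟩ := hsq (4 / 3) (by norm_num) (by linarith)
    refine ⟨s, by exact_mod_cast hs, ?_⟩
    rw [show 3 * r ^ 2 - 4 * s * r + 9 = 0 by rw [hSN]; push_cast; ring]
    ring

section

variable {K : Type*} [Field K] [NumberField K]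

/-- Two conjugate parameters of 3-cycles with product of traces `7` are reciprocal. -/
theorem sq_add_self_add_one_eq_zero_of_mul_eq_seven (hdeg : Module.finrank ℚ K = 2)
    {t τ b b' : K} (ht : b * (t ^ 2 + t) = t ^ 3 + t ^ 2 - 2 * t - 1)
    (hτ : b' * (τ ^ 2 + τ) = τ ^ 3 + τ ^ 2 - 2 * τ - 1) (hb : b * b' = 7) : t ^ 2 + t + 1 = 0 := by
  obtain ⟨h1, h2⟩ := eq_zero_and_eq_zero_of_cubic_form hdeg (b := (-1 : ℤ)) (c := (-2 : ℤ))
    (d := (1 : ℤ)) (Rat.cubic_ne_zero_of_odd (by decide) (by decide))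
    (x := t * τ - 1) (y := -(t + τ + 1)) (by
      push_cast
      linear_combination (-(τ ^ 3 + τ ^ 2 - 2 * τ - 1)) * ht - b * (t ^ 2 + t) * hτ
        + (t ^ 2 + t) * (τ ^ 2 + τ) * hb)
  linear_combination -h1 - t * h2

theorem sq_add_self_add_one_eq_zero_of_six_mul (hdeg : Module.finrank ℚ K = 2)
    {t b : K} (ht : b * (t ^ 2 + t) = t ^ 3 + t ^ 2 - 2 * t - 1)
    (hb : 6 * b ^ 2 + 7 * b + 49 = 0) : t ^ 2 + t + 1 = 0 := by
  have hirr : ∀ q : ℚ, b ≠ q := by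
    rintro q rfl
    have : 6 * q ^ 2 + 7 * q + 49 = 0 := by exact_mod_cast hb
    nlinarith [sq_nonneg q, sq_nonneg (q + 7)]
  obtain ⟨σ, hσ, -⟩ := exists_conjugation hdeg hirr
  have hσb : 6 * (σ b) ^ 2 + 7 * σ b + 49 = 0 := by simpa [map_ofNat] using congrArg σ hb
  have hσt : σ b * ((σ t) ^ 2 + σ t) = (σ t) ^ 3 + (σ t) ^ 2 - 2 * σ t - 1 := by
    simpa [map_ofNat] using congrArg σ ht
  have hS : 6 * (b + σ b) = -7 := by
    refine mul_left_cancel₀ (sub_ne_zero.2 hσ) ?_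
    linear_combination hσb - hb
  have hN : 6 * (b * σ b) = 49 := by linear_combination b * hS - hb
  obtain ⟨τ, hτ⟩ : ∃ τ, τ = σ t := ⟨_, rfl⟩
  obtain ⟨b', hb'⟩ : ∃ b', b' = σ b := ⟨_, rfl⟩
  rw [← hτ, ← hb'] at hσt
  rw [← hb'] at hS hN
  obtain ⟨h1, h2⟩ := eq_zero_and_eq_zero_of_cubic_form hdeg (b := (-8 : ℤ)) (c := (5 : ℤ))
    (d := (1 : ℤ)) (Rat.cubic_ne_zero_of_odd (by decide) (by decide))
    (x := t * τ - 1) (y := -(t + τ + 1)) (by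
      push_cast
      linear_combination (t ^ 2 + t) * (τ ^ 2 + τ) / 6 * (hN + 7 * hS)
        - (τ ^ 3 + τ ^ 2 - 2 * τ - 1 + 7 * (τ ^ 2 + τ)) * ht - (b + 7) * (t ^ 2 + t) * hσt)
  linear_combination -h1 - t * h2

theorem sq_add_self_add_six_ne_zero (hdeg : Module.finrank ℚ K = 2)
    {t b : K} (ht : b * (t ^ 2 + t) = t ^ 3 + t ^ 2 - 2 * t - 1) : b ^ 2 + b + 6 ≠ 0 := by
  intro hb
  have hirr : ∀ q : ℚ, b ≠ q := by
    rintro q rfl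
    have : q ^ 2 + q + 6 = 0 := by exact_mod_cast hb
    nlinarith [sq_nonneg q, sq_nonneg (q + 1)]
  obtain ⟨σ, hσ, hPQ⟩ := exists_conjugation hdeg hirr
  obtain ⟨⟨P, hP⟩, Q, hQ⟩ := hPQ t
  have hσb : (σ b) ^ 2 + σ b + 6 = 0 := by simpa [map_ofNat] using congrArg σ hb
  have hσt : σ b * ((σ t) ^ 2 + σ t) = (σ t) ^ 3 + (σ t) ^ 2 - 2 * σ t - 1 := by
    simpa [map_ofNat] using congrArg σ ht
  have hS : b + σ b = -1 := by
    refine mul_left_cancel₀ (sub_ne_zero.2 hσ) ?_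
    linear_combination hσb - hb
  have hN : b * σ b = 6 := by linear_combination b * hS - hb
  obtain ⟨τ, hτ⟩ : ∃ τ, τ = σ t := ⟨_, rfl⟩
  obtain ⟨b', hb'⟩ : ∃ b', b' = σ b := ⟨_, rfl⟩
  rw [← hτ, ← hb'] at hσt
  rw [← hb'] at hS hN
  rw [← hτ] at hP hQ
  have h1 : (Q - 1) * (P + 1) * (Q + P) = 0 := by
    have : ((Q - 1) * (P + 1) * (Q + P) : K) = 0 := by
      rw [← hP, ← hQ]
      linear_combination (t ^ 2 + t) * (τ ^ 2 + τ) * hS - (τ ^ 2 + τ) * ht - (t ^ 2 + t) * hσt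
    exact_mod_cast this
  have h2 : (Q - 1) ^ 3 - (P + 1) ^ 3 - 3 * (Q - 1) * (P + 1) ^ 2 + Q * (Q + P + 1) = 0 := by
    have : ((Q - 1) ^ 3 - (P + 1) ^ 3 - 3 * (Q - 1) * (P + 1) ^ 2 + Q * (Q + P + 1) : K) = 0 := by
      rw [← hP, ← hQ]
      linear_combination (t ^ 2 + t) * (τ ^ 2 + τ) * (hN - hS)
        - (τ ^ 3 + τ ^ 2 - 2 * τ - 1 - (τ ^ 2 + τ)) * ht - (b - 1) * (t ^ 2 + t) * hσt
    exact_mod_cast this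
  rcases mul_eq_zero.1 h1 with h1 | h1
  · rcases mul_eq_zero.1 h1 with h1 | h1
    · obtain rfl : Q = 1 := by linarith
      refine Rat.cubic_ne_zero_of_odd (b := 0) (c := -1) (d := -1) (by decide) (by decide)
        (P + 1) ?_
      push_cast
      linear_combination -h2
    · obtain rfl : P = -1 := by linarith
      refine Rat.cubic_ne_zero_of_odd (b := -2) (c := 3) (d := -1) (by decide) (by decide) Q ?_
      push_cast
      linear_combination h2
  · obtain rfl : P = -Q := by linarith
    refine Rat.cubic_ne_zero_of_odd (b := -3) (c := 2) (d := -1) (by decide) (by decide) Q ?_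
    push_cast
    linear_combination -h2

end

section

variable {K : Type*} [Field K] [NumberField K]

theorem false_of_three_cycle_parameters (hdeg : Module.finrank ℚ K = 2) {t u b : K} (hb0 : b ≠ 0)
    (ht : b * (t ^ 2 + t) = t ^ 3 + t ^ 2 - 2 * t - 1)
    (hu : -b * (u ^ 2 + u) = u ^ 3 + u ^ 2 - 2 * u - 1)
    (ht1 : t ^ 2 + t + 1 ≠ 0) (hu1 : u ^ 2 + u + 1 ≠ 0) : False := by
  have hB : t ^ 2 + t ≠ 0 := by
    intro h
    have h1 : t = 0 ∨ t + 1 = 0 := mul_eq_zero.1 (by linear_combination h)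
    rcases h1 with rfl | h1
    · norm_num at ht
    · obtain rfl : t = -1 := by linear_combination h1
      norm_num at ht
  have h2b : 2 * b * (t ^ 2 + t) ≠ 0 := mul_ne_zero (mul_ne_zero two_ne_zero hb0) hB
  have htu : t - u ≠ 0 := by
    intro h
    obtain rfl : t = u := sub_eq_zero.1 h
    exact h2b (by linear_combination ht - hu)
  obtain ⟨r, hr⟩ : ∃ r, r = (2 * t * u + 2 + t + u) / (t - u) := ⟨_, rfl⟩
  have hrD : r * (t - u) = 2 * t * u + 2 + t + u := by rw [hr]; field_simp
  have hr1 : r ^ 2 - 1 ≠ 0 := by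
    intro h
    have h1 : (t * u + u + 1) * (t * u + t + 1) = 0 := by
      linear_combination (t - u) ^ 2 / 4 * h - (r * (t - u) + 2 * t * u + 2 + t + u) / 4 * hrD
    rcases mul_eq_zero.1 h1 with h1 | h1
    · refine h2b ?_
      linear_combination ht + (t + 1) ^ 3 * hu + (b * (t + 1) * (u * (t + 1) + t)
        + (u * (t + 1)) ^ 2 - u * (t + 1) + 1 + (t + 1) * (u * (t + 1) - 1)
        - 2 * (t + 1) ^ 2) * h1
    · refine h2b ?_
      linear_combination ht - t ^ 3 * hu + (b * t * (1 - u * t) - (u * t) ^ 2 + u * t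
        + 2 * t ^ 2 - t - 1) * h1
  have hr3 : r ^ 2 ≠ -3 := by
    intro h
    have h1 : (t ^ 2 + t + 1) * (u ^ 2 + u + 1) = 0 := by
      linear_combination (t - u) ^ 2 / 4 * h - (r * (t - u) + 2 * t * u + 2 + t + u) / 4 * hrD
    exact mul_ne_zero ht1 hu1 h1
  have hrel : (b ^ 2 - 7) * (r ^ 2 - 1) + b * r * (r ^ 2 - 9) = 0 := by
    obtain ⟨M, hM⟩ : ∃ M, M = 2 * t * u + 2 + t + u := ⟨_, rfl⟩
    obtain ⟨D, hD⟩ : ∃ D, D = t - u := ⟨_, rfl⟩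
    have h1 : (t ^ 2 + t) ^ 2 * ((b ^ 2 - 7) * (M ^ 2 - D ^ 2) * D + b * M * (M ^ 2 - 9 * D ^ 2))
        = 0 := by
      rw [hM, hD]
      linear_combination ((2 * t * u + 2 + t + u) ^ 2 - (t - u) ^ 2) * (t - u)
          * (b * (t ^ 2 + t) + (t ^ 3 + t ^ 2 - 2 * t - 1)) * ht
        + (2 * t * u + 2 + t + u) * ((2 * t * u + 2 + t + u) ^ 2 - 9 * (t - u) ^ 2)
          * (t ^ 2 + t) * ht
        + (4 * ((t ^ 3 + t ^ 2 - 2 * t - 1) ^ 2 - 7 * (t ^ 2 + t) ^ 2)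
          - (t ^ 3 + t ^ 2 - 2 * t - 1) * (2 * t + 1) * (4 * t ^ 2 + 4 * t - 8))
          * ((u ^ 2 + u) * ht + (t ^ 2 + t) * hu)
    have h2 := (mul_eq_zero.1 h1).resolve_left (pow_ne_zero 2 hB)
    have hD0 : D ≠ 0 := by rw [hD]; exact htu
    rw [hr, ← hM, ← hD]
    field_simp
    linear_combination h2
  have hb7 : b ^ 2 + 7 ≠ 0 := by
    intro h
    have hirr : ∀ q : ℚ, b ≠ q := by
      rintro q rfl
      have : q ^ 2 + 7 = 0 := by exact_mod_cast h
      nlinarith [sq_nonneg q]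
    obtain ⟨σ, hσ, -⟩ := exists_conjugation hdeg hirr
    have hσb : (σ b) ^ 2 + 7 = 0 := by simpa [map_ofNat] using congrArg σ h
    have hσt : σ b * ((σ t) ^ 2 + σ t) = (σ t) ^ 3 + (σ t) ^ 2 - 2 * σ t - 1 := by
      simpa [map_ofNat] using congrArg σ ht
    have hS : σ b + b = 0 :=
      (mul_eq_zero.1 (show (σ b - b) * (σ b + b) = 0 by linear_combination hσb - h)).resolve_left
        (sub_ne_zero.2 hσ)
    exact ht1 (sq_add_self_add_one_eq_zero_of_mul_eq_seven hdeg ht hσt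
      (by linear_combination b * hS - h))
  have hy : ((b ^ 2 + 7) / b * (r ^ 2 - 1)) ^ 2 = (r ^ 2 + 7) * (r ^ 4 + 3 * r ^ 2 + 4) := by
    field_simp
    linear_combination ((b ^ 2 - 7) * (r ^ 2 - 1) - b * r * (r ^ 2 - 9)) * hrel
  by_cases hirr : ∀ q : ℚ, r ≠ q
  · obtain ⟨s, hs, h⟩ := exists_of_sq_eq_sextic hdeg hirr hr3
      (mul_ne_zero (div_ne_zero hb7 hb0) hr1) hy
    have hs1 : s = 1 ∨ s = -1 := mul_self_eq_one_iff.1 ((sq s).symm.trans hs)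
    have hbs : (b ^ 2 + s * b + 6) * (6 * b ^ 2 - 7 * s * b + 49) = 0 := by
      refine (mul_eq_zero.1 (show (r ^ 2 - 1) ^ 2 * _ = 0 from ?_)).resolve_left
        (pow_ne_zero 2 hr1)
      rcases hs1 with rfl | rfl
      · linear_combination b ^ 2 * h + (6 * ((b ^ 2 - 7) * (r ^ 2 - 1) - b * r * (r ^ 2 - 9))
          - b * (r ^ 2 - 1)) * hrel
      · linear_combination b ^ 2 * h + (6 * ((b ^ 2 - 7) * (r ^ 2 - 1) - b * r * (r ^ 2 - 9))
          + b * (r ^ 2 - 1)) * hrel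
    rcases hs1 with rfl | rfl <;> rcases mul_eq_zero.1 hbs with h | h
    · exact sq_add_self_add_six_ne_zero hdeg ht (by linear_combination h)
    · exact hu1 (sq_add_self_add_one_eq_zero_of_six_mul hdeg hu (by linear_combination h))
    · exact sq_add_self_add_six_ne_zero hdeg hu (by linear_combination h)
    · exact ht1 (sq_add_self_add_one_eq_zero_of_six_mul hdeg ht (by linear_combination h))
  · push Not at hirr
    obtain ⟨q, rfl⟩ := hirr
    have hq1 : q ^ 2 - 1 ≠ 0 := by exact_mod_cast hr1
    by_cases hbirr : ∀ q : ℚ, b ≠ q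
    · obtain ⟨σ, hσ, -⟩ := exists_conjugation hdeg hbirr
      have hσb : ((σ b) ^ 2 - 7) * (q ^ 2 - 1) + σ b * q * (q ^ 2 - 9) = 0 := by
        simpa [map_ofNat] using congrArg σ hrel
      have hσt : σ b * ((σ t) ^ 2 + σ t) = (σ t) ^ 3 + (σ t) ^ 2 - 2 * σ t - 1 := by
        simpa [map_ofNat] using congrArg σ ht
      have hN : σ b * b + 7 = 0 := by
        have h1 : ((σ b - b) * (q ^ 2 - 1)) * (σ b * b + 7) = 0 := by
          linear_combination b * hσb - σ b * hrel
        exact (mul_eq_zero.1 h1).resolve_left (mul_ne_zero (sub_ne_zero.2 hσ) hr1)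
      exact hu1 (sq_add_self_add_one_eq_zero_of_mul_eq_seven hdeg hu hσt
        (by linear_combination -hN))
    · push Not at hbirr
      obtain ⟨b, rfl⟩ := hbirr
      have hy' : ((b ^ 2 + 7) / b * (q ^ 2 - 1)) ^ 2 = (q ^ 2 + 7) * (q ^ 4 + 3 * q ^ 2 + 4) := by
        exact_mod_cast hy
      rcases Rat.eq_of_elliptic_eleven (x := q ^ 2) (by rw [hy']; ring) with h | h | h
      · nlinarith [sq_nonneg q]
      · exact hq1 (by linarith)
      · nlinarith [sq_nonneg q]

end

section ThreeCycles

variable {K : Type*} [Field K]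

/-- Each step of a three-cycle is obtained from the previous one on multiplying by a pairwise sum,
and the three steps add up to zero. -/
theorem three_cycle_relation {c x₁ x₂ x₃ : K} (h₁ : x₂ = x₁ ^ 2 + c) (h₂ : x₃ = x₂ ^ 2 + c)
    (h₃ : x₁ = x₃ ^ 2 + c) (hne : x₂ ≠ x₁) :
    1 + (x₁ + x₂) + (x₁ + x₂) * (x₂ + x₃) = 0 := by
  refine (mul_eq_zero.1 ?_).resolve_left (sub_ne_zero.2 hne)
  linear_combination (1 + x₂ + x₃) * h₁ - (x₂ + x₃) * h₂ - h₃

theorem three_cycle_ne {c x₁ x₂ x₃ : K} (h₂ : x₃ = x₂ ^ 2 + c)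
    (h₃ : x₁ = x₃ ^ 2 + c) (hne : x₂ ≠ x₁) : x₃ ≠ x₂ := by
  intro h
  apply hne
  rw [h] at h₃ h₂
  exact h₂.trans h₃.symm

/-- The elementary symmetric functions of a three-cycle. -/
theorem three_cycle_invariants [CharZero K] {c x₁ x₂ x₃ : K} (h₁ : x₂ = x₁ ^ 2 + c)
    (h₂ : x₃ = x₂ ^ 2 + c) (h₃ : x₁ = x₃ ^ 2 + c) (hne : x₂ ≠ x₁) :
    (x₁ + x₂ + x₃) ^ 2 + (x₁ + x₂ + x₃) + c + 2 = 0 ∧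
    2 * (x₁ * x₂ + x₂ * x₃ + x₃ * x₁) = (x₁ + x₂ + x₃) ^ 2 - (x₁ + x₂ + x₃) + 3 * c ∧
    x₁ * x₂ * x₃ = (x₁ + x₂ + x₃) * (x₁ * x₂ + x₂ * x₃ + x₃ * x₁) - 1 := by
  have n₂ := three_cycle_ne h₂ h₃ hne
  have n₃ := three_cycle_ne h₃ h₁ n₂
  have r₁ := three_cycle_relation h₁ h₂ h₃ hne
  have r₂ := three_cycle_relation h₂ h₃ h₁ n₂
  have r₃ := three_cycle_relation h₃ h₁ h₂ n₃
  have s : 2 * (x₁ * x₂ + x₂ * x₃ + x₃ * x₁) =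
      (x₁ + x₂ + x₃) ^ 2 - (x₁ + x₂ + x₃) + 3 * c := by
    linear_combination h₁ + h₂ + h₃
  refine ⟨?_, s, ?_⟩
  · have h3 : (3 : K) ≠ 0 := by norm_num
    refine (mul_eq_zero.1 ?_).resolve_left h3
    linear_combination 2 * r₁ + 2 * r₂ + 2 * r₃ - s
  · linear_combination (-(x₃ + x₁)) * r₁ + r₃

/-- The sum of two consecutive points parametrises the three-cycle. -/
theorem three_cycle_parameter {c x₁ x₂ x₃ : K} (h₁ : x₂ = x₁ ^ 2 + c) (h₂ : x₃ = x₂ ^ 2 + c)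
    (h₃ : x₁ = x₃ ^ 2 + c) (hne : x₂ ≠ x₁) :
    (2 * (x₁ + x₂ + x₃) + 1) * ((x₁ + x₂) ^ 2 + (x₁ + x₂)) =
      (x₁ + x₂) ^ 3 + (x₁ + x₂) ^ 2 - 2 * (x₁ + x₂) - 1 ∧
    (x₁ + x₂) ^ 2 + (x₁ + x₂) + 1 ≠ 0 := by
  have n₂ := three_cycle_ne h₂ h₃ hne
  have n₃ := three_cycle_ne h₃ h₁ n₂
  have r₁ := three_cycle_relation h₁ h₂ h₃ hne
  have r₃ := three_cycle_relation h₃ h₁ h₂ n₃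
  refine ⟨?_, fun h => ?_⟩
  · linear_combination ((x₁ + x₂) + 1) * r₁ + (x₁ + x₂) * r₃
  · have hp : (x₁ + x₂) * (x₃ - x₁) = 0 := by linear_combination r₁ - h
    rcases mul_eq_zero.1 hp with h0 | h0
    · rw [h0] at h
      simp at h
    · exact n₃ (sub_eq_zero.1 h0).symm

/-- Over a quadratic field a quadratic polynomial `z ^ 2 + c` has at most one three-cycle. -/
theorem mem_three_cycle [NumberField K] (hdeg : Module.finrank ℚ K = 2)
    {c x₁ x₂ x₃ y₁ y₂ y₃ : K}
    (h₁ : x₂ = x₁ ^ 2 + c) (h₂ : x₃ = x₂ ^ 2 + c) (h₃ : x₁ = x₃ ^ 2 + c) (hne : x₂ ≠ x₁)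
    (k₁ : y₂ = y₁ ^ 2 + c) (k₂ : y₃ = y₂ ^ 2 + c) (k₃ : y₁ = y₃ ^ 2 + c) (kne : y₂ ≠ y₁) :
    y₁ = x₁ ∨ y₁ = x₂ ∨ y₁ = x₃ := by
  obtain ⟨a₁, a₂, a₃⟩ := three_cycle_invariants h₁ h₂ h₃ hne
  obtain ⟨b₁, b₂, b₃⟩ := three_cycle_invariants k₁ k₂ k₃ kne
  by_cases hs : y₁ + y₂ + y₃ = x₁ + x₂ + x₃
  · rw [hs] at b₂ b₃
    have he : y₁ * y₂ + y₂ * y₃ + y₃ * y₁ = x₁ * x₂ + x₂ * x₃ + x₃ * x₁ :=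
      mul_left_cancel₀ two_ne_zero (b₂.trans a₂.symm)
    rw [he] at b₃
    have hp : (y₁ - x₁) * ((y₁ - x₂) * (y₁ - x₃)) = 0 := by
      linear_combination y₁ ^ 2 * hs - y₁ * he + b₃ - a₃
    simpa [mul_eq_zero, sub_eq_zero] using hp
  · exfalso
    have hsum : y₁ + y₂ + y₃ = -1 - (x₁ + x₂ + x₃) := by
      have hp : (y₁ + y₂ + y₃ - (x₁ + x₂ + x₃)) *
          (y₁ + y₂ + y₃ + (x₁ + x₂ + x₃) + 1) = 0 := by
        linear_combination b₁ - a₁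
      linear_combination (mul_eq_zero.1 hp).resolve_left (sub_ne_zero.2 hs)
    obtain ⟨p, p'⟩ := three_cycle_parameter h₁ h₂ h₃ hne
    obtain ⟨q, q'⟩ := three_cycle_parameter k₁ k₂ k₃ kne
    refine false_of_three_cycle_parameters hdeg (fun hb => hs ?_) p ?_ p' q'
    · linear_combination hsum - hb
    · rw [← q, hsum]
      ring

end ThreeCycles

theorem Set.encard_le_of_forall_mem {α : Type*} {s : Set α} {n : ℕ∞}
    (h : ∀ x ∈ s, s.encard ≤ n) : s.encard ≤ n := by
  rcases s.eq_empty_or_nonempty with rfl | ⟨x, hx⟩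
  · simp
  · exact h x hx

theorem Set.encard_le_of_subset_insert {α : Type*} {s t : Set α} {a : α} {n : ℕ∞}
    (h : s ⊆ insert a t) (ht : t.encard ≤ n) : s.encard ≤ n + 1 :=
  (Set.encard_le_encard h).trans ((Set.encard_insert_le t a).trans (by gcongr))

theorem Set.encard_pair_le {α : Type*} (a b : α) : ({a, b} : Set α).encard ≤ 2 :=
  Set.encard_le_of_subset_insert subset_rfl (Set.encard_singleton b).le

theorem Set.encard_triple_le {α : Type*} (a b d : α) : ({a, b, d} : Set α).encard ≤ 3 :=
  Set.encard_le_of_subset_insert subset_rfl (Set.encard_pair_le b d)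

theorem Set.encard_quadruple_le {α : Type*} (a b d e : α) :
    ({a, b, d, e} : Set α).encard ≤ 4 :=
  Set.encard_le_of_subset_insert subset_rfl (Set.encard_triple_le b d e)

theorem number_of_cycles {K : Type*} [Field K] [NumberField K]
    (hdeg : Module.finrank ℚ K = 2) (c : K) :
    {α : K | HasExactPeriod c 1 α}.encard ≤ 2 ∧
    {α : K | HasExactPeriod c 2 α}.encard ≤ 2 ∧
    {α : K | HasExactPeriod c 3 α}.encard ≤ 3 ∧
    {α : K | HasExactPeriod c 4 α}.encard ≤ 4 := by
  have iter (n : ℕ) (x : K) : (fc c)^[n + 1] x = (fc c)^[n] x ^ 2 + c := by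
    rw [Function.iterate_succ_apply']; rfl
  refine ⟨Set.encard_le_of_forall_mem fun x hx => ?_,
    Set.encard_le_of_forall_mem fun x hx => ?_,
    Set.encard_le_of_forall_mem fun x hx => ?_,
    Set.encard_le_of_forall_mem fun x hx => ?_⟩
  · refine (Set.encard_le_encard fun y hy => ?_).trans (Set.encard_pair_le x (1 - x))
    have hx' : x ^ 2 + c = x := hx.1
    have hy' : y ^ 2 + c = y := hy.1
    have hp : (y - x) * (y - (1 - x)) = 0 := by linear_combination hy' - hx'
    simpa [mul_eq_zero, sub_eq_zero] using hp
  · refine (Set.encard_le_encard fun y hy => ?_).trans (Set.encard_pair_le x (-1 - x))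
    have quad (z : K) (hz : HasExactPeriod c 2 z) : z ^ 2 + z + c + 1 = 0 := by
      have h : (z ^ 2 + c) ^ 2 + c = z := hz.1
      have hne : z ^ 2 + c ≠ z := hz.2 1 le_rfl one_lt_two
      refine (mul_eq_zero.1 ?_).resolve_left (sub_ne_zero.2 hne)
      linear_combination h
    have hp : (y - x) * (y - (-1 - x)) = 0 := by
      linear_combination quad y hy - quad x hx
    simpa [mul_eq_zero, sub_eq_zero] using hp
  · refine (Set.encard_le_encard fun y hy => ?_).trans
      (Set.encard_triple_le x ((fc c)^[1] x) ((fc c)^[2] x))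
    exact mem_three_cycle hdeg (iter 0 x) (iter 1 x) (hx.1.symm.trans (iter 2 x))
      (hx.2 1 le_rfl (by norm_num)) (iter 0 y) (iter 1 y) (hy.1.symm.trans (iter 2 y))
      (hy.2 1 le_rfl (by norm_num))
  · refine (Set.encard_le_encard fun y hy => ?_).trans
      (Set.encard_quadruple_le x ((fc c)^[1] x) ((fc c)^[2] x) ((fc c)^[3] x))
    exact mem_four_cycle hdeg (iter 0 x) (iter 1 x) (iter 2 x) (hx.1.symm.trans (iter 3 x))
      (hx.2 2 one_le_two (by norm_num)) (iter 0 y) (iter 1 y) (iter 2 y)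
      (hy.1.symm.trans (iter 3 y)) (hy.2 2 one_le_two (by norm_num))
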